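/- Let i ≥ 2 be such that #f_{i−1} = 2 and #f_i = #f_{i+1} = 1, write f_i = {d}, and let J be an invariant-factor count function for d. Then lim_{n→∞} ((1/n)·Σ_{m=1}^n J(m) − μ_i·log log n)/(log log n)^{1/2} = −σ_{i−1}/√(2π). -/

import Mathlib

open MeasureTheory ProbabilityTheory Filter

noncomputable section

/-- A key encoding the lexicographic order on pairs `(φ(q), q)`; this is a valid
encoding on prime powers since every prime power satisfies `q ≤ 2 * φ(q)`. -/
def ppKey (q : ℕ) : ℕ := 2 * Nat.totient q ^ 2 + q

/-- The `n`-th smallest key of a prime power (0-indexed). -/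
def ppNthKey (n : ℕ) : ℕ := Nat.nth (fun k => ∃ q : ℕ, IsPrimePow q ∧ ppKey q = k) n

/-- The total φ-sequence `q̃_i` (1-indexed): the enumeration of all prime powers
ordered by nondecreasing totient, with ties broken by increasing size. -/
def qt (i : ℕ) : ℕ := sInf {q : ℕ | IsPrimePow q ∧ ppKey q = ppNthKey (i - 1)}

/-- `lcm(q̃_1, …, q̃_i)`. -/
def Lseq (i : ℕ) : ℕ := (Finset.Icc 1 i).lcm qt

/-- The universal factor order set `f_i`. -/
def UFO (i : ℕ) : Set ℕ :=
  if Nat.totient (qt i) < Nat.totient (qt (i + 1)) then {Lseq i}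
  else {Lseq i, Nat.lcm (Lseq (i - 1)) (qt (i + 1))}

/-- `φ(q̃_i)` as a real number. -/
def phiQ (i : ℕ) : ℝ := (Nat.totient (qt i) : ℝ)

/-- `μ_i = 1/φ(q̃_i) − 1/φ(q̃_{i+1})`. -/
def muSeq (i : ℕ) : ℝ := 1 / phiQ i - 1 / phiQ (i + 1)

/-- `σ_i = (1/φ(q̃_i) + 1/φ(q̃_{i+1}) − 2/(φ(q̃_i)·φ(q̃_{i+1})))^{1/2}`. -/
def sigSeq (i : ℕ) : ℝ :=
  Real.sqrt (1 / phiQ i + 1 / phiQ (i + 1) - 2 / (phiQ i * phiQ (i + 1)))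

/-- `σ_{i;a,b} = (φ(q̃_i)^{−a} + φ(q̃_{i+1})^{−b} − 2/(φ(q̃_i)·φ(q̃_{i+1})))^{1/2}`. -/
def sigAB (i a b : ℕ) : ℝ :=
  Real.sqrt (1 / phiQ i ^ a + 1 / phiQ (i + 1) ^ b - 2 / (phiQ i * phiQ (i + 1)))

/-- `ν_j = (φ(q̃_j)^{−1}·(1 − φ(q̃_j)^{−1}))^{1/2}`. -/
def nuSeq (j : ℕ) : ℝ := Real.sqrt (1 / phiQ j * (1 - 1 / phiQ j))

/-- `J` is an invariant-factor count function for `d`: whenever `(ℤ/mℤ)ˣ` is isomorphic to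
a direct product of cyclic groups `ℤ/λ_1 × ⋯ × ℤ/λ_K` with `1 < λ_1 ∣ λ_2 ∣ ⋯ ∣ λ_K`,
`J m` is the number of indices `j` with `λ_j = d`. -/
def IsInvCount (d : ℕ) (J : ℕ → ℕ) : Prop :=
  ∀ m : ℕ, 1 ≤ m → ∀ K : ℕ, ∀ lam : Fin K → ℕ,
    (∀ j, 1 < lam j) →
    (∀ j k : Fin K, j ≤ k → lam j ∣ lam k) →
    Nonempty ((ZMod m)ˣ ≃* Multiplicative (∀ j : Fin K, ZMod (lam j))) →
    J m = (Finset.univ.filter fun j : Fin K => lam j = d).card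

/-- The number of `m ∈ {1, …, n}` satisfying `P`. -/
def cnt (P : ℕ → Prop) (n : ℕ) : ℕ := {m : ℕ | 1 ≤ m ∧ m ≤ n ∧ P m}.ncard

/-- The average `(1/n)·∑_{m=1}^n J(m)`. -/
def avg (J : ℕ → ℕ) (n : ℕ) : ℝ := (∑ m ∈ Finset.Icc 1 n, (J m : ℝ)) / n

/-- `log log n`. -/
def LL (n : ℕ) : ℝ := Real.log (Real.log n)

/-- The standard normal cumulative distribution function. -/
def Phi (x : ℝ) : ℝ := (Real.sqrt (2 * Real.pi))⁻¹ * ∫ t in Set.Iic x, Real.exp (-t ^ 2 / 2)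

/-- Owen's T-function. -/
def OwenT (h a : ℝ) : ℝ :=
  (2 * Real.pi)⁻¹ * ∫ t in (0:ℝ)..a, Real.exp (-(1 + t ^ 2) * h ^ 2 / 2) / (1 + t ^ 2)

/-- The skew-normal cumulative distribution function with parameter `α`. -/
def PhiSkew (x α : ℝ) : ℝ := Phi x - 2 * OwenT x α

/-- The standard Gaussian probability measure `γ^k` on `ℝ^k`. -/
def stdGaussian (k : ℕ) : Measure (Fin k → ℝ) :=
  Measure.pi fun _ => gaussianReal 0 1

/-- `ω(m;q,1)`: the number of distinct primes `p ∣ m` with `p ≡ 1 (mod q)`. -/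
def omegaQ (m q : ℕ) : ℕ := (m.primeFactors.filter fun p => p % q = 1 % q).card

/-- The correction term `Ē(m;p^α)`. -/
def Ebar (m p α : ℕ) : ℕ :=
  if p ^ α = 2 ∧ 8 ∣ m then 2
  else if p ^ α = 2 ∧ 4 ∣ m ∧ ¬(8 ∣ m) then 1
  else if p = 2 ∧ 2 ≤ α ∧ 2 ^ (α + 2) ∣ m then 1
  else if p ≠ 2 ∧ p ^ (α + 1) ∣ m then 1
  else 0

/-- `prm(m;q)` for a prime power `q = p^α`: the unique `k` such that `p^k` is the cardinality
of the subgroup `{x ∈ (ℤ/mℤ)ˣ : x^p = 1 and x = y^{p^{α−1}} for some y}` (obtained here as the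
`p`-adic valuation of that cardinality; note `p = q.minFac` and `p^{α−1} = q / p`). -/
def prm (m q : ℕ) : ℕ :=
  (Nat.card {x : (ZMod m)ˣ // x ^ q.minFac = 1 ∧ ∃ y : (ZMod m)ˣ, y ^ (q / q.minFac) = x}).factorization
    q.minFac

/-- `m` is `y`-typical: for all prime powers `q₁, q₂` with `φ(q₁) ≤ y` and `φ(q₁) < φ(q₂)`
one has `prm(m;q₁) > prm(m;q₂)`. -/
def yTypical (y : ℝ) (m : ℕ) : Prop :=
  ∀ q₁ q₂ : ℕ, IsPrimePow q₁ → IsPrimePow q₂ →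
    (Nat.totient q₁ : ℝ) ≤ y → Nat.totient q₁ < Nat.totient q₂ →
    prm m q₂ < prm m q₁


/-- The primes `p ≤ n` with `p ≡ 1 (mod q)`. -/
def primesAP (q n : ℕ) : Finset ℕ := (Finset.Icc 1 n).filter fun p => p.Prime ∧ p % q = 1 % q

/-- The sum of the reciprocals of the elements of `P`. -/
def recipSum (P : Finset ℕ) : ℝ := ∑ p ∈ P, (p : ℝ)⁻¹

/-- The number of elements of `P` dividing `m`. -/
def divCount (P : Finset ℕ) (m : ℕ) : ℕ := (P.filter (· ∣ m)).card

/-- The average of `g` over `{1, …, n}`. -/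
def mean (n : ℕ) (g : ℕ → ℝ) : ℝ := (∑ m ∈ Finset.Icc 1 n, g m) / n

/-- The coefficients `Λ(n) / log n` restricted to the residue class `1` modulo `q`. -/
def logWeight (q n : ℕ) : ℝ :=
  ArithmeticFunction.vonMangoldt.residueClass (1 : ZMod q) n / Real.log n

lemma logWeight_nonneg (q n : ℕ) : 0 ≤ logWeight q n :=
  div_nonneg (ArithmeticFunction.vonMangoldt.residueClass_nonneg _ n) (Real.log_natCast_nonneg n)

lemma logWeight_le_one (q n : ℕ) : logWeight q n ≤ 1 :=
  div_le_one_of_le₀ ((ArithmeticFunction.vonMangoldt.residueClass_le _ n).trans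
    ArithmeticFunction.vonMangoldt_le_log) (Real.log_natCast_nonneg n)

lemma logWeight_abscissa_le (q : ℕ) :
    LSeries.abscissaOfAbsConv (fun n => (logWeight q n : ℂ)) ≤ 1 := by
  refine LSeries.abscissaOfAbsConv_le_of_le_const ⟨1, fun n _ => ?_⟩
  rw [Complex.norm_real, Real.norm_of_nonneg (logWeight_nonneg q n)]
  exact logWeight_le_one q n

lemma logMul_logWeight (q : ℕ) :
    LSeries.logMul (fun n => (logWeight q n : ℂ)) =
      fun n => ((ArithmeticFunction.vonMangoldt.residueClass (1 : ZMod q) n : ℝ) : ℂ) := by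
  ext n
  rw [LSeries.logMul, logWeight]
  rcases Nat.lt_or_ge n 2 with h | h
  · interval_cases n
    · simp
    · simp [ArithmeticFunction.vonMangoldt_apply_one]
  · have : Real.log n ≠ 0 := (Real.log_pos (by exact_mod_cast h)).ne'
    have h2 : (Real.log n : ℂ) ≠ 0 := by exact_mod_cast this
    rw [← Complex.natCast_log, Complex.ofReal_div, mul_div_cancel₀ _ h2]

lemma exists_norm_LSeries_logWeight_le (q : ℕ) [NeZero q] :
    ∃ C : ℝ, ∀ x ∈ Set.Ioc (1 : ℝ) 2,
      ‖LSeries (fun n => (logWeight q n : ℂ)) x + ((q.totient : ℝ)⁻¹ * Real.log (x - 1) : ℝ)‖ ≤ C := by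
  set R := ArithmeticFunction.vonMangoldt.LFunctionResidueClassAux (1 : ZMod q) with hR
  have hcont : ContinuousOn (fun x : ℝ => R x) (Set.Icc 1 2) := by
    refine (ArithmeticFunction.vonMangoldt.continuousOn_LFunctionResidueClassAux
      (1 : ZMod q)).comp Complex.continuous_ofReal.continuousOn fun x hx => ?_
    simpa using hx.1
  obtain ⟨C, hC⟩ := isCompact_Icc.exists_bound_of_continuousOn hcont
  set f : ℝ → ℂ := fun x => LSeries (fun n => (logWeight q n : ℂ)) x +
    ((q.totient : ℝ)⁻¹ * Real.log (x - 1) : ℝ) with hf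
  have hderiv : ∀ x ∈ Set.Ioc (1 : ℝ) 2, HasDerivWithinAt f (-R x) (Set.Ioc 1 2) x := by
    intro x hx
    have h1 : HasDerivAt (LSeries (fun n => (logWeight q n : ℂ)))
        (-LSeries (LSeries.logMul (fun n => (logWeight q n : ℂ))) x) x := by
      apply LSeries_hasDerivAt
      refine (logWeight_abscissa_le q).trans_lt ?_
      simpa using (by exact_mod_cast hx.1 : (1 : EReal) < (x : EReal))
    have h2 : HasDerivAt (fun y : ℝ => (q.totient : ℝ)⁻¹ * Real.log (y - 1))
        ((q.totient : ℝ)⁻¹ * (1 / (x - 1))) x := by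
      refine HasDerivAt.const_mul _ ?_
      have := ((hasDerivAt_id x).sub_const 1).log (by simp; linarith [hx.1])
      simpa using this
    have h3 := (h1.comp_ofReal.add h2.ofReal_comp).hasDerivWithinAt (s := Set.Ioc 1 2)
    convert! h3 using 1
    have h4 := ArithmeticFunction.vonMangoldt.eqOn_LFunctionResidueClassAux (q := q)
      (a := 1) isUnit_one (x := (x : ℂ)) (by simpa using hx.1)
    rw [hR, h4, logMul_logWeight]
    push_cast
    ring
  have key := fun x (hx : x ∈ Set.Ioc (1 : ℝ) 2) =>
    (convex_Ioc (1 : ℝ) 2).norm_image_sub_le_of_norm_hasDerivWithin_le hderiv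
      (C := C) (fun y hy => by rw [norm_neg]; exact hC y (Set.Ioc_subset_Icc_self hy))
      (Set.right_mem_Ioc.mpr one_lt_two) hx
  have hC0 : 0 ≤ C := (norm_nonneg _).trans (hC 1 (by simp))
  refine ⟨C + ‖f 2‖, fun x hx => ?_⟩
  have h5 := key x hx
  have h6 : ‖x - 2‖ ≤ 1 := by
    rw [Real.norm_eq_abs, abs_le]; constructor <;> linarith [hx.1, hx.2]
  calc ‖f x‖ = ‖(f x - f 2) + f 2‖ := by simp
    _ ≤ ‖f x - f 2‖ + ‖f 2‖ := norm_add_le _ _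
    _ ≤ C + ‖f 2‖ := by nlinarith

/-- The indicator function of the primes congruent to `1` modulo `q`. -/
def primeAPInd (q n : ℕ) : ℝ := if n.Prime ∧ n % q = 1 % q then 1 else 0

lemma primeAPInd_nonneg (q n : ℕ) : 0 ≤ primeAPInd q n := by
  unfold primeAPInd; split_ifs <;> norm_num

lemma primeAPInd_eq_logWeight (q n : ℕ) (hn : n.Prime) : primeAPInd q n = logWeight q n := by
  have hcast : ((n : ZMod q) = 1) ↔ n % q = 1 % q := by
    have := ZMod.natCast_eq_natCast_iff n 1 q
    rw [Nat.cast_one] at this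
    exact this
  have hlog : Real.log n ≠ 0 := (Real.log_pos (by exact_mod_cast hn.one_lt)).ne'
  unfold primeAPInd logWeight ArithmeticFunction.vonMangoldt.residueClass
  by_cases h : (n : ZMod q) = 1
  · rw [Set.indicator_of_mem (by simpa using h), ArithmeticFunction.vonMangoldt_apply_prime hn,
      div_self hlog, if_pos ⟨hn, hcast.1 h⟩]
  · rw [Set.indicator_of_notMem (by simpa using h), zero_div, if_neg fun h' => h (hcast.2 h'.2)]

lemma primeAPInd_le_logWeight (q n : ℕ) : primeAPInd q n ≤ logWeight q n := by
  by_cases hn : n.Prime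
  · exact (primeAPInd_eq_logWeight q n hn).le
  · simpa [primeAPInd, hn] using logWeight_nonneg q n

lemma summable_logWeight (q : ℕ) {x : ℝ} (hx : 1 < x) :
    Summable fun n : ℕ => logWeight q n / (n : ℝ) ^ x :=
  LSeries.summable_real_of_abscissaOfAbsConv_lt
    ((logWeight_abscissa_le q).trans_lt (by exact_mod_cast hx))

lemma summable_primeAPInd (q : ℕ) {x : ℝ} (hx : 1 < x) :
    Summable fun n : ℕ => primeAPInd q n / (n : ℝ) ^ x := by
  refine Summable.of_nonneg_of_le (fun n => by have := primeAPInd_nonneg q n; positivity)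
    (fun n => ?_) (summable_logWeight q hx)
  gcongr
  exact primeAPInd_le_logWeight q n

lemma LSeries_logWeight_eq (q : ℕ) (x : ℝ) :
    LSeries (fun n => (logWeight q n : ℂ)) x = ((∑' n, logWeight q n / (n : ℝ) ^ x : ℝ) : ℂ) := by
  rw [LSeries, Complex.ofReal_tsum]
  refine tsum_congr fun n => ?_
  rcases eq_or_ne n 0 with rfl | hn
  · simp [logWeight]
  · rw [LSeries.term_of_ne_zero hn]
    push_cast
    rw [Complex.ofReal_cpow (Nat.cast_nonneg n)]
    simp

lemma exists_abs_primeSum_sub_le (q : ℕ) [NeZero q] :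
    ∃ C : ℝ, ∀ x ∈ Set.Ioc (1 : ℝ) 2,
      |∑' n, primeAPInd q n / (n : ℝ) ^ x + (q.totient : ℝ)⁻¹ * Real.log (x - 1)| ≤ C := by
  obtain ⟨C, hC⟩ := exists_norm_LSeries_logWeight_le q
  have hs := ArithmeticFunction.vonMangoldt.summable_residueClass_non_primes_div (1 : ZMod q)
  set B : ℝ := ∑' n : ℕ, (if n.Prime then 0 else
    ArithmeticFunction.vonMangoldt.residueClass (1 : ZMod q) n) / (n : ℝ) with hB
  refine ⟨C + B / Real.log 2, fun x hx => ?_⟩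
  have h1 := hC x hx
  rw [LSeries_logWeight_eq, ← Complex.ofReal_add, Complex.norm_real, Real.norm_eq_abs] at h1
  have hdiff0 : 0 ≤ ∑' n, logWeight q n / (n : ℝ) ^ x - ∑' n, primeAPInd q n / (n : ℝ) ^ x := by
    rw [sub_nonneg]
    refine (summable_primeAPInd q hx.1).tsum_le_tsum (fun n => ?_) (summable_logWeight q hx.1)
    gcongr
    exact primeAPInd_le_logWeight q n
  have hdiff : ∑' n, logWeight q n / (n : ℝ) ^ x - ∑' n, primeAPInd q n / (n : ℝ) ^ x
      ≤ B / Real.log 2 := by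
    rw [← (summable_logWeight q hx.1).tsum_sub (summable_primeAPInd q hx.1), hB, ← tsum_div_const]
    refine ((summable_logWeight q hx.1).sub (summable_primeAPInd q hx.1)).tsum_le_tsum
      (fun n => ?_) (hs.div_const _)
    by_cases hn : n.Prime
    · simp [hn, primeAPInd_eq_logWeight q n hn]
    · simp only [hn, if_false]
      have h0 : primeAPInd q n = 0 := by simp [primeAPInd, hn]
      rw [h0, zero_div, sub_zero]
      rcases Nat.lt_or_ge n 2 with h | h
      · interval_cases n
        · simp [logWeight]
        · simp only [logWeight, Nat.cast_one, Real.log_one, div_zero, zero_div]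
          have := ArithmeticFunction.vonMangoldt.residueClass_nonneg (1 : ZMod q) 1
          positivity
      · have hn2 : (2 : ℝ) ≤ n := by exact_mod_cast h
        have hl : Real.log 2 ≤ Real.log n := Real.log_le_log (by norm_num) hn2
        have hl2 : 0 < Real.log 2 := Real.log_pos (by norm_num)
        have hr := ArithmeticFunction.vonMangoldt.residueClass_nonneg (1 : ZMod q) n
        have hp : (n : ℝ) ≤ (n : ℝ) ^ x := by
          conv_lhs => rw [← Real.rpow_one (n : ℝ)]
          exact Real.rpow_le_rpow_of_exponent_le (by linarith) hx.1.le
        rw [logWeight, div_div, div_div, mul_comm (n : ℝ)]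
        gcongr
  rw [abs_le] at h1 ⊢
  constructor <;> linarith [h1.1, h1.2]

lemma abs_cutoff_sub_exp_le {u : ℝ} (hu : 0 ≤ u) :
    |(if u ≤ 1 then (1 : ℝ) else 0) - Real.exp (-u)| ≤ 3 * (Real.exp (-u) - Real.exp (-(2 * u))) := by
  have h2 : Real.exp (-(2 * u)) = Real.exp (-u) * Real.exp (-u) := by
    rw [← Real.exp_add]; ring_nf
  have hpos : 0 < Real.exp (-u) := Real.exp_pos _
  have hle1 : Real.exp (-u) ≤ 1 := Real.exp_le_one_iff.2 (by linarith)
  have he : Real.exp (-1) < 0.3678794412 := Real.exp_neg_one_lt_d9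
  have he' : 0.36787944116 < Real.exp (-1) := Real.exp_neg_one_gt_d9
  rw [h2]
  split_ifs with h
  · have : Real.exp (-1) ≤ Real.exp (-u) := Real.exp_le_exp.2 (by linarith)
    rw [abs_of_nonneg (by linarith)]
    nlinarith
  · have : Real.exp (-u) ≤ Real.exp (-1) := Real.exp_le_exp.2 (by linarith)
    rw [zero_sub, abs_neg, abs_of_pos hpos]
    nlinarith

/-- Mertens' theorem for the primes congruent to `1` modulo `q`. -/
lemma mertens_primesAP (q : ℕ) (hq : 0 < q) :
    ∃ C : ℝ, 0 ≤ C ∧ ∀ x : ℝ, Real.exp 2 ≤ x →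
      |recipSum (primesAP q ⌊x⌋₊) - Real.log (Real.log x) / q.totient| ≤ C := by
  have : NeZero q := ⟨hq.ne'⟩
  obtain ⟨C, hC⟩ := exists_abs_primeSum_sub_le q
  have hC0 : 0 ≤ C := (abs_nonneg _).trans (hC 2 (by norm_num))
  refine ⟨C + 3 * ((q.totient : ℝ)⁻¹ * Real.log 2 + 2 * C), by positivity, fun x hx => ?_⟩
  set t := Real.log x with ht
  have hxpos : 0 < x := (Real.exp_pos 2).trans_le hx
  have ht2 : 2 ≤ t := by
    rw [ht]; exact (Real.le_log_iff_exp_le hxpos).2 hx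
  have hm1 : 1 + 1 / t ∈ Set.Ioc (1 : ℝ) 2 := by
    constructor
    · have : 0 < 1 / t := by positivity
      linarith
    · have : 1 / t ≤ 1 := by rw [div_le_one (by linarith)]; linarith
      linarith
  have hm2 : 1 + 2 / t ∈ Set.Ioc (1 : ℝ) 2 := by
    constructor
    · have : 0 < 2 / t := by positivity
      linarith
    · have : 2 / t ≤ 1 := by rw [div_le_one (by linarith)]; linarith
      linarith
  have hs1 := summable_primeAPInd q hm1.1
  have hs2 := summable_primeAPInd q hm2.1
  have b1 := hC _ hm1
  have b2 := hC _ hm2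
  set S1 := ∑' n, primeAPInd q n / (n : ℝ) ^ (1 + 1 / t) with hS1
  set S2 := ∑' n, primeAPInd q n / (n : ℝ) ^ (1 + 2 / t) with hS2
  have hfin : HasSum (fun n : ℕ => if n ∈ primesAP q ⌊x⌋₊ then (n : ℝ)⁻¹ else 0)
      (recipSum (primesAP q ⌊x⌋₊)) := by
    have : recipSum (primesAP q ⌊x⌋₊) = ∑ n ∈ primesAP q ⌊x⌋₊,
        if n ∈ primesAP q ⌊x⌋₊ then (n : ℝ)⁻¹ else 0 :=
      Finset.sum_congr rfl fun n hn => by simp [hn]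
    rw [this]
    exact hasSum_sum_of_ne_finset_zero fun b hb => by simp [hb]
  have hpt : ∀ n : ℕ, |(if n ∈ primesAP q ⌊x⌋₊ then (n : ℝ)⁻¹ else 0) -
      primeAPInd q n / (n : ℝ) ^ (1 + 1 / t)| ≤ 3 * (primeAPInd q n / (n : ℝ) ^ (1 + 1 / t) -
        primeAPInd q n / (n : ℝ) ^ (1 + 2 / t)) := by
    intro n
    by_cases hn : n.Prime ∧ n % q = 1 % q
    · have hnpos : (0 : ℝ) < n := by exact_mod_cast hn.1.pos
      have hu := abs_cutoff_sub_exp_le (u := Real.log n / t)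
        (div_nonneg (Real.log_natCast_nonneg n) (by linarith))
      have hmem : n ∈ primesAP q ⌊x⌋₊ ↔ Real.log n / t ≤ 1 := by
        rw [div_le_one (by linarith), ht, Real.log_le_log_iff hnpos hxpos, primesAP,
          Finset.mem_filter, Finset.mem_Icc, Nat.le_floor_iff hxpos.le]
        exact ⟨fun h => h.1.2, fun h => ⟨⟨hn.1.one_le, h⟩, hn⟩⟩
      have hind : primeAPInd q n = 1 := by simp [primeAPInd, hn]
      have e1 : ∀ c : ℝ, 1 / (n : ℝ) ^ (1 + c / t) =
          (n : ℝ)⁻¹ * Real.exp (-(c * (Real.log n / t))) := by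
        intro c
        rw [Real.rpow_add hnpos, Real.rpow_one, Real.rpow_def_of_pos hnpos, one_div, mul_inv,
          Real.exp_neg]
        congr 3
        ring
      rw [hind, e1, e1, one_mul]
      have e2 : (if n ∈ primesAP q ⌊x⌋₊ then (n : ℝ)⁻¹ else 0) =
          (n : ℝ)⁻¹ * (if Real.log n / t ≤ 1 then 1 else 0) := by
        simp only [hmem]; split_ifs <;> simp
      rw [e2, ← mul_sub, ← mul_sub, abs_mul, abs_of_pos (inv_pos.2 hnpos)]
      calc _ ≤ (n : ℝ)⁻¹ * _ := mul_le_mul_of_nonneg_left hu (inv_pos.2 hnpos).le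
        _ = _ := by ring
    · have : n ∉ primesAP q ⌊x⌋₊ := fun h => hn (Finset.mem_filter.1 h).2
      simp [this, primeAPInd, hn]
  have habs : |recipSum (primesAP q ⌊x⌋₊) - S1| ≤ 3 * (S1 - S2) := by
    rw [abs_le]
    have hsum : HasSum (fun n : ℕ => 3 * (primeAPInd q n / (n : ℝ) ^ (1 + 1 / t) -
        primeAPInd q n / (n : ℝ) ^ (1 + 2 / t))) (3 * (S1 - S2)) :=
      (hs1.hasSum.sub hs2.hasSum).mul_left 3
    have hd := hfin.sub hs1.hasSum
    exact ⟨hasSum_le (fun n => (abs_le.1 (hpt n)).1) hsum.neg hd,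
      hasSum_le (fun n => (abs_le.1 (hpt n)).2) hd hsum⟩
  have hlog1 : Real.log (1 + 1 / t - 1) = -Real.log t := by
    rw [add_sub_cancel_left, one_div, Real.log_inv]
  have hlog2 : Real.log (1 + 2 / t - 1) = Real.log 2 - Real.log t := by
    rw [add_sub_cancel_left, Real.log_div (by norm_num) (by linarith)]
  rw [hlog1] at b1
  rw [hlog2] at b2
  rw [div_eq_inv_mul]
  rw [abs_le] at habs b1 b2 ⊢
  constructor <;> nlinarith [habs.1, habs.2, b1.1, b1.2, b2.1, b2.2]

lemma card_multiples_Icc (n d : ℕ) : ((Finset.Icc 1 n).filter (d ∣ ·)).card = n / d := by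
  have := Nat.Ioc_filter_dvd_card_eq_div n d
  rwa [← Finset.Icc_add_one_left_eq_Ioc, zero_add] at this

lemma prod_primes_dvd_iff {s : Finset ℕ} (hs : ∀ p ∈ s, p.Prime) (m : ℕ) :
    ∏ p ∈ s, p ∣ m ↔ ∀ p ∈ s, p ∣ m :=
  ⟨fun h _ hp => (Finset.dvd_prod_of_mem _ hp).trans h,
    fun h => Finset.prod_primes_dvd m (fun p hp => (hs p hp).prime) h⟩

lemma sum_prod_ite_dvd {R : Type*} [CommRing R] {P : Finset ℕ} (hP : ∀ p ∈ P, p.Prime)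
    (w : ℕ → R) (n : ℕ) :
    ∑ m ∈ Finset.Icc 1 n, ∏ p ∈ P, (1 + if p ∣ m then w p else 0) =
      ∑ s ∈ P.powerset, (∏ p ∈ s, w p) * ((n / ∏ p ∈ s, p : ℕ) : R) := by
  simp_rw [Finset.prod_one_add]
  rw [Finset.sum_comm]
  refine Finset.sum_congr rfl fun s hs => ?_
  have hs' : ∀ p ∈ s, p.Prime := fun p hp => hP p (Finset.mem_powerset.1 hs hp)
  rw [← card_multiples_Icc, Finset.card_filter, Nat.cast_sum, Finset.mul_sum]
  refine Finset.sum_congr rfl fun m _ => ?_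
  rw [Finset.prod_ite_zero]
  simp only [← prod_primes_dvd_iff hs']
  split_ifs <;> simp

lemma mean_mono {n : ℕ} {f g : ℕ → ℝ} (h : ∀ m ∈ Finset.Icc 1 n, f m ≤ g m) :
    mean n f ≤ mean n g := by
  unfold mean
  gcongr with m hm
  exact h m hm

lemma mean_add (n : ℕ) (f g : ℕ → ℝ) : mean n (fun m => f m + g m) = mean n f + mean n g := by
  simp [mean, Finset.sum_add_distrib, add_div]

lemma mean_sub (n : ℕ) (f g : ℕ → ℝ) : mean n (fun m => f m - g m) = mean n f - mean n g := by
  simp [mean, Finset.sum_sub_distrib, sub_div]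

lemma mean_const_mul (n : ℕ) (c : ℝ) (f : ℕ → ℝ) : mean n (fun m => c * f m) = c * mean n f := by
  simp [mean, ← Finset.mul_sum, mul_div_assoc]

lemma mean_sum {ι : Type*} (s : Finset ι) (n : ℕ) (f : ι → ℕ → ℝ) :
    mean n (fun m => ∑ j ∈ s, f j m) = ∑ j ∈ s, mean n (f j) := by
  simp only [mean, ← Finset.sum_div]
  rw [Finset.sum_comm]

lemma mean_const {n : ℕ} (hn : 0 < n) (c : ℝ) : mean n (fun _ => c) = c := by
  have : (n : ℝ) ≠ 0 := by positivity
  simp [mean, this]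

lemma mean_nonneg {n : ℕ} {f : ℕ → ℝ} (h : ∀ m, 0 ≤ f m) : 0 ≤ mean n f :=
  div_nonneg (Finset.sum_nonneg fun m _ => h m) (Nat.cast_nonneg n)

lemma abs_mean_le (n : ℕ) (f : ℕ → ℝ) : |mean n f| ≤ mean n fun m => |f m| := by
  unfold mean
  rw [abs_div, Nat.abs_cast]
  gcongr
  exact Finset.abs_sum_le_sum_abs _ _

lemma mean_ind_dvd (n d : ℕ) : mean n (fun m => if d ∣ m then 1 else 0) = ((n / d : ℕ) : ℝ) / n := by
  rw [mean, ← card_multiples_Icc, Finset.card_filter]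
  simp

lemma natDiv_div_le {n : ℕ} (hn : 0 < n) (d : ℕ) : ((n / d : ℕ) : ℝ) / n ≤ (d : ℝ)⁻¹ := by
  have hn' : (0 : ℝ) < n := by exact_mod_cast hn
  rw [div_le_iff₀ hn', inv_mul_eq_div]
  exact Nat.cast_div_le

lemma natDiv_div_ge {n : ℕ} (hn : 0 < n) (d : ℕ) :
    (d : ℝ)⁻¹ - (n : ℝ)⁻¹ ≤ ((n / d : ℕ) : ℝ) / n := by
  have hn' : (0 : ℝ) < n := by exact_mod_cast hn
  rw [le_div_iff₀ hn', sub_mul, inv_mul_cancel₀ hn'.ne', inv_mul_eq_div]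
  have := Nat.lt_floor_add_one ((n : ℝ) / d)
  rw [Nat.floor_div_eq_div] at this
  linarith

lemma recipSum_nonneg (P : Finset ℕ) : 0 ≤ recipSum P :=
  Finset.sum_nonneg fun p _ => by positivity

lemma divCount_eq_sum (P : Finset ℕ) (m : ℕ) :
    (divCount P m : ℝ) = ∑ p ∈ P, if p ∣ m then (1 : ℝ) else 0 := by
  rw [divCount, Finset.card_filter]
  push_cast
  rfl

lemma mean_divCount_le {n : ℕ} (hn : 0 < n) (P : Finset ℕ) :
    mean n (fun m => divCount P m) ≤ recipSum P := by
  simp_rw [divCount_eq_sum]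
  rw [mean_sum]
  refine Finset.sum_le_sum fun p _ => ?_
  rw [mean_ind_dvd]
  exact natDiv_div_le hn p

lemma mean_divCount_ge {n : ℕ} (hn : 0 < n) {P : Finset ℕ} (hP : P ⊆ Finset.Icc 1 n) :
    recipSum P - 1 ≤ mean n (fun m => divCount P m) := by
  have hn' : (0 : ℝ) < n := by exact_mod_cast hn
  simp_rw [divCount_eq_sum]
  rw [mean_sum]
  have h1 : ∑ p ∈ P, ((p : ℝ)⁻¹ - (n : ℝ)⁻¹) ≤
      ∑ p ∈ P, mean n (fun m => if p ∣ m then 1 else 0) :=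
    Finset.sum_le_sum fun p _ => by rw [mean_ind_dvd]; exact natDiv_div_ge hn p
  have h2 : (P.card : ℝ) ≤ n := by
    exact_mod_cast (Finset.card_le_card hP).trans (by simp)
  have h3 : (P.card : ℝ) * (n : ℝ)⁻¹ ≤ 1 := by
    rw [← div_eq_mul_inv, div_le_one hn']; exact h2
  rw [Finset.sum_sub_distrib, Finset.sum_const, nsmul_eq_mul] at h1
  unfold recipSum
  linarith

lemma mean_divCount_sq_le {n : ℕ} (hn : 0 < n) {P : Finset ℕ} (hP : ∀ p ∈ P, p.Prime) :
    mean n (fun m => (divCount P m : ℝ) ^ 2) ≤ recipSum P ^ 2 + recipSum P := by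
  simp_rw [divCount_eq_sum, sq, Finset.sum_mul_sum]
  rw [mean_sum]
  simp_rw [mean_sum]
  have hterm : ∀ p ∈ P, ∀ r ∈ P,
      mean n (fun m => (if p ∣ m then (1 : ℝ) else 0) * if r ∣ m then 1 else 0) ≤
        (p : ℝ)⁻¹ * (r : ℝ)⁻¹ + if p = r then (p : ℝ)⁻¹ else 0 := by
    intro p hp r hr
    have e : (fun m => (if p ∣ m then (1 : ℝ) else 0) * if r ∣ m then 1 else 0) =
        fun m => if Nat.lcm p r ∣ m then 1 else 0 := by
      ext m
      simp only [Nat.lcm_dvd_iff]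
      split_ifs <;> simp_all
    rw [e, mean_ind_dvd]
    refine (natDiv_div_le hn _).trans ?_
    by_cases h : p = r
    · subst h
      simp only [Nat.lcm_self, if_true]
      have : 0 ≤ (p : ℝ)⁻¹ * (p : ℝ)⁻¹ := by positivity
      linarith
    · rw [((Nat.coprime_primes (hP p hp) (hP r hr)).2 h).lcm_eq_mul]
      simp [h, mul_comm]
  calc _ ≤ ∑ p ∈ P, ∑ r ∈ P, ((p : ℝ)⁻¹ * (r : ℝ)⁻¹ + if p = r then (p : ℝ)⁻¹ else 0) :=
        Finset.sum_le_sum fun p hp => Finset.sum_le_sum fun r hr => hterm p hp r hr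
    _ = _ := by
        simp only [Finset.sum_add_distrib, ← Finset.sum_mul_sum, recipSum, Finset.sum_ite_eq]
        congr 1
        exact Finset.sum_congr rfl fun p hp => by simp [hp]

/-- The Turán variance bound. -/
lemma mean_divCount_sub_sq_le {n : ℕ} (hn : 0 < n) {P : Finset ℕ} (hP : ∀ p ∈ P, p.Prime)
    (hPn : P ⊆ Finset.Icc 1 n) :
    mean n (fun m => ((divCount P m : ℝ) - recipSum P) ^ 2) ≤ 3 * recipSum P := by
  have e : (fun m => ((divCount P m : ℝ) - recipSum P) ^ 2) =
      fun m => ((divCount P m : ℝ) ^ 2 - 2 * recipSum P * divCount P m) + recipSum P ^ 2 := by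
    ext m; ring
  rw [e, mean_add, mean_sub, mean_const_mul, mean_const hn]
  have h1 := mean_divCount_sq_le hn hP
  have h2 := mean_divCount_ge hn hPn
  have h3 := recipSum_nonneg P
  nlinarith

lemma pow_divCount_eq {z : ℝ} (P : Finset ℕ) (m : ℕ) :
    z ^ divCount P m = ∏ p ∈ P, (1 + if p ∣ m then z - 1 else 0) := by
  rw [divCount, ← Finset.prod_const, Finset.prod_filter]
  refine Finset.prod_congr rfl fun p _ => ?_
  split_ifs <;> ring

lemma mean_pow_divCount_le {n : ℕ} (hn : 0 < n) {P : Finset ℕ} (hP : ∀ p ∈ P, p.Prime)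
    {z : ℝ} (hz : 1 ≤ z) :
    mean n (fun m => z ^ divCount P m) ≤ Real.exp ((z - 1) * recipSum P) := by
  simp_rw [pow_divCount_eq]
  rw [mean, sum_prod_ite_dvd hP, Finset.sum_div]
  calc _ ≤ ∑ s ∈ P.powerset, ∏ p ∈ s, ((z - 1) * (p : ℝ)⁻¹) := by
        refine Finset.sum_le_sum fun s _ => ?_
        rw [Finset.prod_mul_distrib, mul_div_assoc]
        refine mul_le_mul_of_nonneg_left ((natDiv_div_le hn _).trans_eq ?_)
          (Finset.prod_nonneg fun p _ => by linarith)
        push_cast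
        rw [Finset.prod_inv_distrib]
    _ = ∏ p ∈ P, (1 + (z - 1) * (p : ℝ)⁻¹) := (Finset.prod_one_add _).symm
    _ ≤ ∏ p ∈ P, Real.exp ((z - 1) * (p : ℝ)⁻¹) := by
        refine Finset.prod_le_prod (fun p _ => ?_) fun p _ => ?_
        · have : 0 ≤ (z - 1) * (p : ℝ)⁻¹ := mul_nonneg (by linarith) (by positivity)
          linarith
        · rw [add_comm]; exact Real.add_one_le_exp _
    _ = _ := by rw [← Real.exp_sum, recipSum, Finset.mul_sum]

lemma abs_natDiv_div_sub_inv_le {n d : ℕ} (hn : 0 < n) (hd : 0 < d) {δ : ℝ} (hδ0 : 0 ≤ δ)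
    (hδ1 : δ ≤ 1) :
    |((n / d : ℕ) : ℝ) / n - (d : ℝ)⁻¹| ≤ (n : ℝ) ^ (-δ) * (d : ℝ) ^ (δ - 1) := by
  have hn' : (0 : ℝ) < n := by exact_mod_cast hn
  have hd' : (0 : ℝ) < d := by exact_mod_cast hd
  set A := (d : ℝ)⁻¹ - ((n / d : ℕ) : ℝ) / n with hA
  have h0 : 0 ≤ A := sub_nonneg.2 (natDiv_div_le hn d)
  have h1 : A ≤ (n : ℝ)⁻¹ := by have := natDiv_div_ge hn d; linarith
  have h2 : A ≤ (d : ℝ)⁻¹ := by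
    have : 0 ≤ ((n / d : ℕ) : ℝ) / n := by positivity
    linarith
  rw [abs_sub_comm, abs_of_nonneg h0]
  calc A = A ^ δ * A ^ (1 - δ) := by
        rcases h0.eq_or_lt with h | h
        · rw [← h]
          by_cases hδ : δ = 0
          · simp [hδ]
          · simp [Real.zero_rpow hδ]
        · rw [← Real.rpow_add h]; simp
    _ ≤ ((n : ℝ)⁻¹) ^ δ * ((d : ℝ)⁻¹) ^ (1 - δ) := by gcongr
    _ = _ := by
        rw [Real.inv_rpow hn'.le, Real.inv_rpow hd'.le, ← Real.rpow_neg hn'.le,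
          ← Real.rpow_neg hd'.le]
        congr 2; ring

/-- Comparison of a multiplicative statistic of the divisors from `P` with its independent model. -/
lemma norm_mean_prod_sub_le {n : ℕ} (hn : 0 < n) {P : Finset ℕ} (hP : ∀ p ∈ P, p.Prime)
    (w : ℕ → ℂ) {δ : ℝ} (hδ0 : 0 ≤ δ) (hδ1 : δ ≤ 1) :
    ‖(∑ m ∈ Finset.Icc 1 n, ∏ p ∈ P, (1 + if p ∣ m then w p else 0)) / n -
      ∏ p ∈ P, (1 + w p * (p : ℂ)⁻¹)‖ ≤
      (n : ℝ) ^ (-δ) * ∏ p ∈ P, (1 + ‖w p‖ * (p : ℝ) ^ (δ - 1)) := by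
  rw [sum_prod_ite_dvd hP, Finset.sum_div, Finset.prod_one_add, Finset.prod_one_add,
    ← Finset.sum_sub_distrib, Finset.mul_sum]
  refine (norm_sum_le _ _).trans (Finset.sum_le_sum fun s hs => ?_)
  have hs' : ∀ p ∈ s, p.Prime := fun p hp => hP p (Finset.mem_powerset.1 hs hp)
  have hd : 0 < ∏ p ∈ s, p := Finset.prod_pos fun p hp => (hs' p hp).pos
  rw [Finset.prod_mul_distrib, Finset.prod_mul_distrib, mul_div_assoc, ← mul_sub, norm_mul,
    norm_prod, Real.finsetProd_rpow _ _ (fun p _ => Nat.cast_nonneg p), mul_left_comm]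
  refine mul_le_mul_of_nonneg_left ?_ (Finset.prod_nonneg fun p _ => norm_nonneg _)
  have := abs_natDiv_div_sub_inv_le hn hd hδ0 hδ1
  rw [← Real.norm_eq_abs, ← Complex.norm_real] at this
  push_cast at this ⊢
  rwa [Finset.prod_inv_distrib]

lemma factorial_dvd_pow_mul_prod {q : ℕ} (hq : IsPrimePow q) (N : ℕ) :
    N.factorial ∣ q ^ N * ∏ k ∈ Finset.range N, (q * (k + 1) + 1) := by
  obtain ⟨r, a, hr, ha, rfl⟩ := (isPrimePow_nat_iff q).1 hq
  rw [← Nat.ordProj_mul_ordCompl_eq_self N.factorial r]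
  have hfact : N.factorial ≠ 0 := N.factorial_ne_zero
  refine Nat.mul_dvd_mul ?_ ?_
  · have : Fact r.Prime := ⟨hr⟩
    have h1 : N.factorial.factorization r ≤ N := by
      have h2 := sub_one_mul_padicValNat_factorial (p := r) N
      rw [Nat.factorization_def _ hr]
      have h3 : 1 * padicValNat r N.factorial ≤ (r - 1) * padicValNat r N.factorial :=
        Nat.mul_le_mul_right _ (by have := hr.two_le; omega)
      omega
    rw [← pow_mul]
    exact pow_dvd_pow r (h1.trans (Nat.le_mul_of_pos_left N ha))
  · set A := N.factorial / r ^ N.factorial.factorization r with hA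
    have hAdvd : A ∣ N.factorial := Nat.ordCompl_dvd _ _
    have hcop : Nat.Coprime A (r ^ a) :=
      (Nat.Coprime.pow_left a (Nat.coprime_ordCompl hr hfact)).symm
    obtain ⟨u, hu⟩ := ((ZMod.isUnit_iff_coprime (r ^ a) A).2 hcop.symm).exists_right_inv
    have hApos : 0 < A := Nat.ordCompl_pos r hfact
    have : NeZero A := ⟨hApos.ne'⟩
    obtain ⟨v, rfl⟩ := ZMod.natCast_zmod_surjective u
    have hasc : ((∏ k ∈ Finset.range N, (v + 1 + k) : ℕ) : ZMod A) = 0 := by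
      rw [ZMod.natCast_eq_zero_iff, ← Nat.ascFactorial_eq_prod_range]
      exact hAdvd.trans (Nat.factorial_dvd_ascFactorial _ _)
    rw [← ZMod.natCast_eq_zero_iff]
    have hprod : ((∏ k ∈ Finset.range N, (r ^ a * (k + 1) + 1) : ℕ) : ZMod A) =
        ((r ^ a : ℕ) : ZMod A) ^ N * ((∏ k ∈ Finset.range N, (v + 1 + k) : ℕ) : ZMod A) := by
      push_cast
      rw [← Finset.card_range N, ← Finset.prod_const, Finset.card_range,
        ← Finset.prod_mul_distrib]
      refine Finset.prod_congr rfl fun k _ => ?_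
      push_cast at hu
      linear_combination -hu
    rw [hprod, hasc, mul_zero]

lemma eq_mul_add_one_of_mod {q p : ℕ} (hq : 2 ≤ q) (hp : p.Prime) (h : p % q = 1 % q) :
    ∃ k, p = q * (k + 1) + 1 := by
  rw [Nat.mod_eq_of_lt hq] at h
  have h1 := Nat.div_add_mod p q
  rw [h] at h1
  have h2 : p / q ≠ 0 := by
    intro h0
    rw [h0] at h1
    have := hp.two_le
    omega
  exact ⟨p / q - 1, by rw [Nat.sub_add_cancel (Nat.pos_of_ne_zero h2)]; omega⟩

lemma prod_primes_ap_le {q : ℕ} (hq : IsPrimePow q) (N : ℕ) {S : Finset ℕ}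
    (hS : ∀ p ∈ S, p.Prime ∧ p % q = 1 % q ∧ N < p ∧ p ≤ q * N + 1) :
    ∏ p ∈ S, p ≤ q ^ (3 * N) := by
  have hq2 : 2 ≤ q := hq.two_le
  have h1 : ∏ p ∈ S, p ∣ ∏ k ∈ Finset.range N, (q * (k + 1) + 1) := by
    refine Finset.prod_primes_dvd _ (fun p hp => (hS p hp).1.prime) fun p hp => ?_
    obtain ⟨k, rfl⟩ := eq_mul_add_one_of_mod hq2 (hS p hp).1 (hS p hp).2.1
    refine Finset.dvd_prod_of_mem (fun k => q * (k + 1) + 1) (Finset.mem_range.2 ?_)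
    have := Nat.le_of_mul_le_mul_left (Nat.le_of_succ_le_succ (hS _ hp).2.2.2) (by omega : 0 < q)
    omega
  have hcop : Nat.Coprime (∏ p ∈ S, p) N.factorial :=
    Nat.Coprime.prod_left fun p hp =>
      ((hS p hp).1.coprime_iff_not_dvd).2 fun h => by
        have := ((hS p hp).1.dvd_factorial).1 h
        have := (hS p hp).2.2.1
        omega
  have h2 := hcop.mul_dvd_of_dvd_of_dvd (h1.mul_left (q ^ N)) (factorial_dvd_pow_mul_prod hq N)
  have h3 : (∏ p ∈ S, p) * N.factorial ≤ q ^ N * ∏ k ∈ Finset.range N, (q * (k + 1) + 1) :=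
    Nat.le_of_dvd (by positivity) h2
  have h4 : ∏ k ∈ Finset.range N, (q * (k + 1) + 1) ≤ (q * q) ^ N * N.factorial := by
    rw [← Finset.prod_range_add_one_eq_factorial]
    calc _ ≤ ∏ k ∈ Finset.range N, (q * q * (k + 1)) := by
          refine Finset.prod_le_prod (fun _ _ => Nat.zero_le _) fun k _ => ?_
          nlinarith [Nat.zero_le k, Nat.mul_le_mul_right (k + 1) (Nat.mul_le_mul_left q hq2)]
      _ = _ := by rw [Finset.prod_mul_distrib, Finset.prod_const, Finset.card_range]
  refine Nat.le_of_mul_le_mul_right ?_ N.factorial_pos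
  calc _ ≤ q ^ N * ((q * q) ^ N * N.factorial) := h3.trans (Nat.mul_le_mul_left _ h4)
    _ = _ := by ring

lemma sum_inv_dyadic_block_le {q : ℕ} (hq : IsPrimePow q) (hq4 : 4 ≤ q) {j : ℕ} (hj : 2 ≤ j)
    {S : Finset ℕ} (hS : ∀ p ∈ S, p.Prime ∧ p % q = 1 % q ∧ 2 ^ j ≤ p ∧ p < 2 ^ (j + 1)) :
    ∑ p ∈ S, (p : ℝ)⁻¹ ≤ 12 / Real.log 2 * (Real.log q / q) * (j : ℝ)⁻¹ := by
  have hl2 : 0 < Real.log 2 := Real.log_pos (by norm_num)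
  have hq0 : (0 : ℝ) < q := by positivity
  have hlq : 0 ≤ Real.log q := Real.log_natCast_nonneg q
  rcases S.eq_empty_or_nonempty with rfl | ⟨p₀, hp₀⟩
  · simp; positivity
  set x := 2 ^ j with hx
  have hx4 : 4 ≤ x := by
    calc 4 = 2 ^ 2 := rfl
      _ ≤ 2 ^ j := Nat.pow_le_pow_right (by norm_num) hj
  set N := 2 * x / q + 1 with hN
  have hdm := Nat.div_add_mod (2 * x) q
  have hml := Nat.mod_lt (2 * x) (by omega : 0 < q)
  have hqN : 2 * x ≤ q * N := by rw [hN, mul_add]; omega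
  have hNx : N < x := by
    have : 2 * x / q ≤ 2 * x / 4 := Nat.div_le_div_left hq4 (by norm_num)
    omega
  have hq2x : q ≤ 2 * x := by
    obtain ⟨k, hk⟩ := eq_mul_add_one_of_mod (by omega) (hS _ hp₀).1 (hS _ hp₀).2.1
    have h := (hS _ hp₀).2.2.2
    rw [pow_succ] at h
    have : q ≤ q * (k + 1) := Nat.le_mul_of_pos_right q (by omega)
    omega
  have hNq : (N : ℝ) ≤ 4 * x / q := by
    rw [le_div_iff₀ hq0]
    have : N * q ≤ 4 * x := by rw [hN, add_mul, mul_comm]; omega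
    exact_mod_cast this
  have hxr : (0 : ℝ) < x := by positivity
  have hprod : x ^ S.card ≤ q ^ (3 * N) := by
    refine le_trans ?_ (prod_primes_ap_le hq N fun p hp => ⟨(hS p hp).1, (hS p hp).2.1, ?_, ?_⟩)
    · rw [← Finset.prod_const]
      exact Finset.prod_le_prod (fun _ _ => Nat.zero_le _) fun p hp => (hS p hp).2.2.1
    · have := (hS p hp).2.2.1; omega
    · have := (hS p hp).2.2.2
      rw [pow_succ] at this
      omega
  have hlog : (S.card : ℝ) * (j * Real.log 2) ≤ 3 * N * Real.log q := by
    have h : Real.log ((x : ℝ) ^ S.card) ≤ Real.log ((q : ℝ) ^ (3 * N)) :=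
      Real.log_le_log (by positivity) (by exact_mod_cast hprod)
    rw [Real.log_pow, Real.log_pow, hx] at h
    push_cast at h
    rwa [Real.log_pow] at h
  have hj0 : (0 : ℝ) < j := by positivity
  have hcard : (S.card : ℝ) ≤ 12 / Real.log 2 * (Real.log q / q) * (j : ℝ)⁻¹ * x := by
    have h : (S.card : ℝ) * (j * Real.log 2) ≤ 3 * (4 * x / q) * Real.log q :=
      hlog.trans (by gcongr)
    rw [← le_div_iff₀ (by positivity)] at h
    refine h.trans_eq ?_
    field_simp
    ring
  calc ∑ p ∈ S, (p : ℝ)⁻¹ ≤ ∑ _p ∈ S, (x : ℝ)⁻¹ := by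
        refine Finset.sum_le_sum fun p hp => ?_
        have : (x : ℝ) ≤ p := by exact_mod_cast (hS p hp).2.2.1
        gcongr
    _ = S.card * (x : ℝ)⁻¹ := by rw [Finset.sum_const, nsmul_eq_mul]
    _ ≤ _ := by
        rw [← div_eq_mul_inv, div_le_iff₀ hxr]
        exact hcard

/-- A bound for the reciprocal sum of the primes `p ≡ 1 (mod q)` that is uniform in `q`. -/
lemma recipSum_primesAP_le {q n : ℕ} (hq : IsPrimePow q) (hq4 : 4 ≤ q) (hn : 3 ≤ n) :
    recipSum (primesAP q n) ≤ 100 * (1 + Real.log (Real.log n)) / Real.sqrt q := by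
  have hl2 : 0.69 < Real.log 2 := by have := Real.log_two_gt_d9; linarith
  have hl2' : Real.log 2 < 0.7 := by have := Real.log_two_lt_d9; linarith
  have hlogn : 1 ≤ Real.log n := by
    rw [Real.le_log_iff_exp_le (by positivity)]
    have h3 : (3 : ℝ) ≤ n := by exact_mod_cast hn
    have := Real.exp_one_lt_d9
    linarith
  have hLL : 0 ≤ Real.log (Real.log n) := Real.log_nonneg hlogn
  have hmem : ∀ p ∈ primesAP q n, p.Prime ∧ p % q = 1 % q ∧ p ≤ n ∧ 4 ≤ p := by
    intro p hp
    obtain ⟨h1, h2, h3⟩ := Finset.mem_filter.1 hp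
    obtain ⟨k, hk⟩ := eq_mul_add_one_of_mod (by omega) h2 h3
    have : q ≤ q * (k + 1) := Nat.le_mul_of_pos_right q (by omega)
    exact ⟨h2, h3, (Finset.mem_Icc.1 h1).2, by omega⟩
  set J := Nat.log 2 n with hJ
  have hmaps : ∀ p ∈ primesAP q n, Nat.log 2 p ∈ Finset.Icc 1 J := by
    intro p hp
    obtain ⟨_, _, h3, h4⟩ := hmem p hp
    refine Finset.mem_Icc.2 ⟨?_, Nat.log_mono_right h3⟩
    exact Nat.log_pos (by norm_num) (by omega)
  have hJ1 : 1 ≤ J := Nat.log_pos (by norm_num) (by omega)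
  have hsum : recipSum (primesAP q n) ≤
      ∑ j ∈ Finset.Icc 1 J, 12 / Real.log 2 * (Real.log q / q) * (j : ℝ)⁻¹ := by
    rw [recipSum, ← Finset.sum_fiberwise_of_maps_to hmaps]
    refine Finset.sum_le_sum fun j hj => ?_
    rcases Nat.lt_or_ge j 2 with hj2 | hj2
    · rw [Finset.sum_eq_zero]
      · have := Real.log_natCast_nonneg q
        positivity
      · intro p hp
        obtain ⟨h1, h2⟩ := Finset.mem_filter.1 hp
        have h3 : 2 ≤ Nat.log 2 p := Nat.le_log_of_pow_le (by norm_num) (hmem p h1).2.2.2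
        omega
    · refine sum_inv_dyadic_block_le hq hq4 hj2 fun p hp => ?_
      obtain ⟨h1, rfl⟩ := Finset.mem_filter.1 hp
      have h4 := (hmem p h1).2.2.2
      exact ⟨(hmem p h1).1, (hmem p h1).2.1, Nat.pow_log_le_self 2 (by omega),
        Nat.lt_pow_succ_log_self (by norm_num) p⟩
  have hharm : ∑ j ∈ Finset.Icc 1 J, (j : ℝ)⁻¹ ≤ 1 + Real.log J := by
    have := harmonic_le_one_add_log J
    rw [harmonic_eq_sum_Icc] at this
    push_cast at this
    exact this
  have hlogJ : Real.log J ≤ 1 + Real.log (Real.log n) := by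
    have h1 : (J : ℝ) * Real.log 2 ≤ Real.log n := by
      have h2 : ((2 : ℝ) ^ J) ≤ n := by exact_mod_cast Nat.pow_log_le_self 2 (by omega)
      rw [← Real.log_pow]
      exact Real.log_le_log (by positivity) h2
    have h2 : (J : ℝ) ≤ 2 * Real.log n := by nlinarith
    have h3 : (0 : ℝ) < J := by exact_mod_cast hJ1
    have h4 := Real.log_le_log h3 h2
    rw [Real.log_mul (by norm_num) (by linarith)] at h4
    linarith
  have hq0 : (0 : ℝ) < q := by positivity
  have hlq : Real.log q / q ≤ 2 / Real.sqrt q := by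
    have hs : 0 < Real.sqrt q := Real.sqrt_pos.2 hq0
    have hss : Real.sqrt q * Real.sqrt q = q := Real.mul_self_sqrt hq0.le
    rw [div_le_div_iff₀ hq0 hs]
    have h1 : Real.log q = 2 * Real.log (Real.sqrt q) := by
      rw [Real.log_sqrt hq0.le]; ring
    have h2 : Real.log (Real.sqrt q) ≤ Real.sqrt q :=
      (Real.log_le_sub_one_of_pos hs).trans (by linarith)
    nlinarith
  rw [← Finset.mul_sum] at hsum
  have hlqn : 0 ≤ Real.log q := Real.log_natCast_nonneg q
  calc _ ≤ 12 / Real.log 2 * (Real.log q / q) * ∑ j ∈ Finset.Icc 1 J, (j : ℝ)⁻¹ := hsum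
    _ ≤ 18 * (2 / Real.sqrt q) * (2 * (1 + Real.log (Real.log n))) := by
        have : 12 / Real.log 2 ≤ 18 := by
          rw [div_le_iff₀ (by linarith)]; linarith
        gcongr
        linarith
    _ ≤ _ := by
        rw [← mul_div_assoc, div_mul_eq_mul_div]
        gcongr ?_ / _
        nlinarith

lemma primesAP_subset (q n : ℕ) : primesAP q n ⊆ Finset.Icc 1 n := Finset.filter_subset _ _

lemma prime_of_mem_primesAP {q n p : ℕ} (hp : p ∈ primesAP q n) : p.Prime :=
  (Finset.mem_filter.1 hp).2.1

lemma tendsto_LL : Tendsto LL atTop atTop :=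
  Real.tendsto_log_atTop.comp (Real.tendsto_log_atTop.comp tendsto_natCast_atTop_atTop)

lemma exists_abs_recipSum_sub_le (q : ℕ) (hq : 0 < q) :
    ∃ C, 0 ≤ C ∧ ∀ᶠ n : ℕ in atTop, |recipSum (primesAP q n) - LL n / q.totient| ≤ C := by
  obtain ⟨C, hC, h⟩ := mertens_primesAP q hq
  refine ⟨C, hC, ?_⟩
  filter_upwards [tendsto_natCast_atTop_atTop.eventually_ge_atTop (Real.exp 2)] with n hn
  simpa [LL] using h n hn

/-- The average of `ω(m; q, 1)` over `m ≤ n` is `log log n / φ(q) + O(1)`. -/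
lemma exists_abs_mean_divCount_sub_le (q : ℕ) (hq : 0 < q) :
    ∃ C, ∀ᶠ n : ℕ in atTop,
      |mean n (fun m => (divCount (primesAP q n) m : ℝ)) - LL n / q.totient| ≤ C := by
  obtain ⟨C, -, h⟩ := exists_abs_recipSum_sub_le q hq
  refine ⟨C + 1, ?_⟩
  filter_upwards [h, eventually_gt_atTop 0] with n hn hn0
  have h1 := mean_divCount_le hn0 (primesAP q n)
  have h2 := mean_divCount_ge hn0 (primesAP_subset q n)
  rw [abs_le] at hn ⊢
  constructor <;> linarith

lemma max_sub_zero_le_sq_div {μ : ℝ} (hμ : 0 < μ) (u : ℝ) : max (u - μ) 0 ≤ u ^ 2 / (4 * μ) := by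
  rw [max_le_iff, le_div_iff₀ (by positivity)]
  exact ⟨by nlinarith [sq_nonneg (u - 2 * μ)], by positivity⟩

/-- The mean of the part of `ω(m; q, 1)` lying on the far side of `c log log n`
(above for `s = 1`, below for `s = -1`) is bounded. -/
lemma exists_mean_max_divCount_sub_le (q : ℕ) (hq : 0 < q) {c s : ℝ} (hs : s ^ 2 = 1)
    (hc : 0 < s * (c - (q.totient : ℝ)⁻¹)) :
    ∃ C, ∀ᶠ n : ℕ in atTop,
      mean n (fun m => max (s * (divCount (primesAP q n) m - c * LL n)) 0) ≤ C := by
  obtain ⟨C, hC, h⟩ := exists_abs_recipSum_sub_le q hq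
  set η := s * (c - (q.totient : ℝ)⁻¹) / 2 with hη
  have hη0 : 0 < η := by positivity
  refine ⟨3 * ((q.totient : ℝ)⁻¹ + C) / (4 * η), ?_⟩
  filter_upwards [h, eventually_gt_atTop 0, tendsto_LL.eventually_ge_atTop 1,
    tendsto_LL.eventually_ge_atTop (C / η)] with n hn hn0 hL1 hL2
  set M := recipSum (primesAP q n)
  have hs' : |s| = 1 := by
    rw [← sq_abs] at hs
    exact (pow_eq_one_iff_of_nonneg (abs_nonneg s) two_ne_zero).1 hs
  have hgap : η * LL n ≤ s * (c * LL n - M) := by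
    have h1 : |s * (M - LL n / q.totient)| ≤ C := by rw [abs_mul, hs', one_mul]; exact hn
    rw [div_le_iff₀ hη0] at hL2
    have h2 : s * (c * LL n - M) = 2 * η * LL n - s * (M - LL n / q.totient) := by
      rw [hη]; ring
    rw [h2]
    linarith [(abs_le.1 h1).2]
  have hμ : 0 < η * LL n := by positivity
  have hM : M ≤ ((q.totient : ℝ)⁻¹ + C) * LL n := by
    have := (abs_le.1 hn).2
    rw [div_eq_inv_mul] at this
    nlinarith
  calc mean n (fun m => max (s * (divCount (primesAP q n) m - c * LL n)) 0)
      ≤ mean n (fun m => (4 * (η * LL n))⁻¹ * ((divCount (primesAP q n) m : ℝ) - M) ^ 2) := by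
        refine mean_mono fun m _ => ?_
        have := max_sub_zero_le_sq_div hμ (s * ((divCount (primesAP q n) m : ℝ) - M))
        rw [mul_pow, hs, one_mul, div_eq_inv_mul] at this
        refine le_trans (max_le_max ?_ le_rfl) this
        linarith
    _ ≤ (4 * (η * LL n))⁻¹ * (3 * (((q.totient : ℝ)⁻¹ + C) * LL n)) := by
        rw [mean_const_mul]
        gcongr
        exact (mean_divCount_sub_sq_le hn0 (fun p hp => prime_of_mem_primesAP hp)
          (primesAP_subset q n)).trans (by gcongr)
    _ = 3 * ((q.totient : ℝ)⁻¹ + C) / (4 * η) := by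
        have : LL n ≠ 0 := by linarith
        field_simp

/-- For large prime powers `q`, the values of `ω(m; q, 1)` beyond `c log log n` have
a mean which is summable in `q`. -/
lemma exists_mean_sum_max_divCount_sub_le {c : ℝ} (hc : 0 < c) :
    ∃ (Q : ℕ) (C : ℝ), ∀ᶠ n : ℕ in atTop,
      mean n (fun m => ∑ q ∈ (Finset.Ioc Q n).filter IsPrimePow,
        max ((divCount (primesAP q n) m : ℝ) - c * LL n) 0) ≤ C := by
  refine ⟨max 8 ⌈Real.exp (800 / c)⌉₊, ∑' q : ℕ, 1 / (q : ℝ) ^ 2, ?_⟩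
  filter_upwards [eventually_ge_atTop 3, tendsto_LL.eventually_ge_atTop 1,
    tendsto_LL.eventually_ge_atTop (8 / c)] with n hn hL1 hL2
  rw [mean_sum]
  refine le_trans (Finset.sum_le_sum (g := fun q : ℕ => 1 / (q : ℝ) ^ 2) fun q hq => ?_)
    (Summable.sum_le_tsum _ (fun _ _ => by positivity)
      (Real.summable_one_div_nat_pow.2 one_lt_two))
  obtain ⟨hq1, hqp⟩ := Finset.mem_filter.1 hq
  have hq2 := (Finset.mem_Ioc.1 hq1).1
  rw [max_lt_iff] at hq2
  have hq0 : (0 : ℝ) < q := by exact_mod_cast (by omega : 0 < q)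
  have hlog : 800 / c ≤ Real.log q := by
    rw [Real.le_log_iff_exp_le hq0]
    exact (Nat.le_ceil _).trans (by exact_mod_cast hq2.2.le)
  have hsq : Real.exp 1 ≤ √q := by
    have : (9 : ℝ) ≤ q := by exact_mod_cast hq2.1
    refine Real.le_sqrt_of_sq_le ?_
    nlinarith [Real.exp_one_lt_d9, Real.exp_pos 1]
  have hz1 : 1 ≤ √(q : ℝ) := le_trans (by linarith [Real.add_one_le_exp 1]) hsq
  have hz0 : 0 < √(q : ℝ) := by linarith
  have hlogz : Real.log √(q : ℝ) = Real.log q / 2 := Real.log_sqrt hq0.le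
  have hpt : ∀ m, max ((divCount (primesAP q n) m : ℝ) - c * LL n) 0 ≤
      Real.exp (-(c * LL n * (Real.log q / 2))) * √(q : ℝ) ^ divCount (primesAP q n) m := by
    intro m
    have e : Real.exp (-(c * LL n * (Real.log q / 2))) * √(q : ℝ) ^ divCount (primesAP q n) m =
        √(q : ℝ) ^ ((divCount (primesAP q n) m : ℝ) - c * LL n) := by
      rw [sub_eq_add_neg, Real.rpow_add hz0, Real.rpow_natCast, mul_comm,
        Real.rpow_def_of_pos hz0 (-_), hlogz]
      congr 2; ring
    rw [e]
    refine max_le ?_ (by positivity)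
    by_cases hx : 0 ≤ (divCount (primesAP q n) m : ℝ) - c * LL n
    · calc _ ≤ Real.exp ((divCount (primesAP q n) m : ℝ) - c * LL n) := by
            linarith [Real.add_one_le_exp ((divCount (primesAP q n) m : ℝ) - c * LL n)]
        _ = Real.exp 1 ^ ((divCount (primesAP q n) m : ℝ) - c * LL n) := by
            rw [← Real.exp_mul, one_mul]
        _ ≤ _ := Real.rpow_le_rpow (Real.exp_pos _).le hsq hx
    · exact (not_le.1 hx).le.trans (by positivity)
  refine (mean_mono fun m _ => hpt m).trans ?_
  rw [mean_const_mul]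
  have h2 := mean_pow_divCount_le (n := n) (by omega) (P := primesAP q n)
    (fun p hp => prime_of_mem_primesAP hp) hz1
  have h3 := recipSum_primesAP_le (n := n) hqp (by omega) hn
  have h4 : (√(q : ℝ) - 1) * recipSum (primesAP q n) ≤ 100 * (1 + LL n) := by
    rw [le_div_iff₀ hz0] at h3
    have := recipSum_nonneg (primesAP q n)
    rw [LL]
    nlinarith
  have h5 : 1 / (q : ℝ) ^ 2 = Real.exp (-(2 * Real.log q)) := by
    rw [Real.exp_neg, one_div, mul_comm, Real.exp_mul, Real.exp_log hq0]
    norm_cast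
  rw [h5]
  calc _ ≤ Real.exp (-(c * LL n * (Real.log q / 2))) * Real.exp (100 * (1 + LL n)) := by
        gcongr
        exact h2.trans (Real.exp_le_exp.2 h4)
    _ ≤ _ := by
        rw [← Real.exp_add, Real.exp_le_exp]
        rw [div_le_iff₀ hc] at hL2 hlog
        have h0 : 0 ≤ Real.log q := Real.log_nonneg (by exact_mod_cast (by omega : 1 ≤ q))
        nlinarith

/-- The distribution of `X m`, where `m` is uniform on `{1, …, n}`. -/
def unifLaw (n : ℕ) (X : ℕ → ℝ) : Measure ℝ :=
  (n : ENNReal)⁻¹ • ∑ m ∈ Finset.Icc 1 n, Measure.dirac (X m)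

lemma isProbabilityMeasure_unifLaw {n : ℕ} (hn : 0 < n) (X : ℕ → ℝ) :
    IsProbabilityMeasure (unifLaw n X) := by
  refine ⟨?_⟩
  simp only [unifLaw, Measure.smul_apply, Measure.coe_finsetSum, Finset.sum_apply, measure_univ,
    Finset.sum_const, Nat.card_Icc, add_tsub_cancel_right, nsmul_eq_mul, mul_one, smul_eq_mul]
  exact ENNReal.inv_mul_cancel (by simpa using hn.ne') (by simp)

lemma integral_unifLaw {E : Type*} [NormedAddCommGroup E] [NormedSpace ℝ E] [CompleteSpace E]
    (n : ℕ) (X : ℕ → ℝ) (f : ℝ → E) :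
    ∫ x, f x ∂(unifLaw n X) = (n : ℝ)⁻¹ • ∑ m ∈ Finset.Icc 1 n, f (X m) := by
  rw [unifLaw, integral_smul_measure, integral_finsetSum_measure]
  · simp
  · intro m _
    exact integrable_dirac (by simp)

lemma integral_abs_gaussianReal_zero_one :
    ∫ x, |x| ∂(gaussianReal 0 1) = √(2 / Real.pi) := by
  rw [integral_gaussianReal_eq_integral_smul one_ne_zero]
  have h1 : ∀ x : ℝ, gaussianPDFReal 0 1 x • |x| =
      (fun y => (√(2 * Real.pi))⁻¹ * (y ^ (1 : ℝ) * Real.exp (-(1 / 2) * y ^ (2 : ℝ)))) |x| := by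
    intro x
    simp only [gaussianPDFReal_def, smul_eq_mul, Real.rpow_one, Real.rpow_two, sq_abs]
    simp only [NNReal.coe_one, mul_one, sub_zero]
    rw [show -x ^ 2 / 2 = -(1 / 2) * x ^ 2 by ring]
    ring
  rw [integral_congr_ae (.of_forall h1)]
  rw [integral_comp_abs (f := fun y => (√(2 * Real.pi))⁻¹ *
    (y ^ (1 : ℝ) * Real.exp (-(1 / 2) * y ^ (2 : ℝ)))), integral_const_mul,
    integral_rpow_mul_exp_neg_mul_rpow two_pos (by norm_num) (by norm_num)]
  norm_num
  have : √(2 : ℝ) ≠ 0 := by positivity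
  field_simp
  norm_num

lemma integral_abs_gaussianReal_zero (v : NNReal) :
    ∫ x, |x| ∂(gaussianReal 0 v) = √v * √(2 / Real.pi) := by
  have h := gaussianReal_map_const_mul (μ := 0) (v := 1) √(v : ℝ)
  have hv : (NNReal.mk (√(v : ℝ) ^ 2) (sq_nonneg _)) * 1 = v := by
    ext; simp
  rw [hv, mul_zero] at h
  rw [← h, integral_map (by fun_prop) (by fun_prop)]
  simp_rw [abs_mul, abs_of_nonneg (Real.sqrt_nonneg _)]
  rw [integral_const_mul, integral_abs_gaussianReal_zero_one]

lemma integral_sq_gaussianReal_zero (v : NNReal) : ∫ x, x ^ 2 ∂(gaussianReal 0 v) = v := by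
  have h := variance_id_gaussianReal (μ := 0) (v := v)
  rwa [variance_of_integral_eq_zero (by fun_prop) (by simp)] at h

lemma abs_le_min_add_sq_div {K : ℝ} (hK : 0 < K) (x : ℝ) : |x| ≤ min |x| K + x ^ 2 / K := by
  rcases le_total |x| K with h | h
  · rw [min_eq_left h]; exact le_add_of_nonneg_right (by positivity)
  · rw [min_eq_right h]
    have : |x| ≤ x ^ 2 / K := by
      rw [le_div_iff₀ hK, ← sq_abs]; nlinarith [abs_nonneg x]
    linarith

/-- If the characteristic functions of `X n` on `{1, …, n}` converge to that of a centred Gaussian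
and the second moments are bounded, then the first absolute moments converge as well. -/
lemma tendsto_mean_abs_of_tendsto_charFun {X : ℕ → ℕ → ℝ} {v : NNReal} {C : ℝ}
    (hchar : ∀ t : ℝ, Tendsto (fun n : ℕ => (∑ m ∈ Finset.Icc 1 n,
      Complex.exp (t * X n m * Complex.I)) / n) atTop (nhds (Complex.exp (-(v * t ^ 2 / 2)))))
    (hsq : ∀ᶠ n in atTop, mean n (fun m => X n m ^ 2) ≤ C) :
    Tendsto (fun n => mean n fun m => |X n m|) atTop (nhds (√v * √(2 / Real.pi))) := by
  let μ : ℕ → ProbabilityMeasure ℝ := fun n =>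
    ⟨unifLaw (n + 1) (X (n + 1)), isProbabilityMeasure_unifLaw n.succ_pos _⟩
  let μ₀ : ProbabilityMeasure ℝ := ⟨gaussianReal 0 v, inferInstance⟩
  have hμ : ∀ n, (μ n : Measure ℝ) = unifLaw (n + 1) (X (n + 1)) := fun _ => rfl
  have hμ₀ : (μ₀ : Measure ℝ) = gaussianReal 0 v := rfl
  have hlaw : Tendsto μ atTop (nhds μ₀) := by
    rw [ProbabilityMeasure.tendsto_iff_tendsto_charFun]
    intro t
    rw [hμ₀, charFun_gaussianReal]
    simp only [hμ, charFun_apply_real]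
    have := (tendsto_add_atTop_iff_nat 1).2 (hchar t)
    convert this using 2
    · rw [integral_unifLaw, Complex.real_smul, div_eq_inv_mul]
      push_cast; rfl
    · simp
  rw [ProbabilityMeasure.tendsto_iff_forall_integral_tendsto] at hlaw
  have htrunc : ∀ K : ℝ, 0 < K → Tendsto (fun n => mean n fun m => min |X n m| K) atTop
      (nhds (∫ x, min |x| K ∂(gaussianReal 0 v))) := by
    intro K hK
    have := hlaw (BoundedContinuousFunction.ofNormedAddCommGroup (fun x : ℝ => min |x| K)
      (by fun_prop) K (fun x => by
        rw [Real.norm_of_nonneg (le_min (abs_nonneg x) hK.le)]; exact min_le_right _ _))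
    rw [← tendsto_add_atTop_iff_nat 1]
    refine this.congr fun n => ?_
    simp only [hμ, BoundedContinuousFunction.coe_ofNormedAddCommGroup]
    rw [integral_unifLaw, mean, smul_eq_mul, div_eq_inv_mul]
  have hint : Integrable (fun x : ℝ => |x|) (gaussianReal 0 v) :=
    ((memLp_id_gaussianReal (μ := 0) (v := v) 1).integrable (by simp)).abs
  have hint2 : Integrable (fun x : ℝ => x ^ 2) (gaussianReal 0 v) :=
    (memLp_id_gaussianReal (μ := 0) (v := v) 2).integrable_sq
  have hintK : ∀ K : ℝ, Integrable (fun x : ℝ => min |x| K) (gaussianReal 0 v) := fun K =>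
    hint.inf (integrable_const K)
  rw [← integral_abs_gaussianReal_zero, Metric.tendsto_atTop']
  intro ε hε
  set K := 3 * (max C 0 + v + 1) / ε with hKdef
  have hC0 : 0 ≤ max C 0 := le_max_right _ _
  have hv0 : (0 : ℝ) ≤ v := v.2
  have hK : 0 < K := by positivity
  have hKε : (max C 0 + v + 1) / K = ε / 3 := by rw [hKdef]; field_simp
  have e1 : ∫ x, |x| ∂(gaussianReal 0 v) ≤ ∫ x, min |x| K ∂(gaussianReal 0 v) + v / K := by
    rw [← integral_sq_gaussianReal_zero v, ← integral_div, ← integral_add (hintK K)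
      (hint2.div_const K)]
    exact integral_mono hint ((hintK K).add (hint2.div_const K)) (abs_le_min_add_sq_div hK)
  have e2 : ∫ x, min |x| K ∂(gaussianReal 0 v) ≤ ∫ x, |x| ∂(gaussianReal 0 v) :=
    integral_mono (hintK K) hint fun x => min_le_left _ _
  have e5 : (v : ℝ) / K ≤ ε / 3 := by rw [← hKε]; gcongr; linarith
  have e6 : max C 0 / K ≤ ε / 3 := by rw [← hKε]; gcongr; linarith
  obtain ⟨N, hN⟩ := eventually_atTop.1 (hsq.and
    (Metric.tendsto_nhds.1 (htrunc K hK) (ε / 3) (by positivity)))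
  refine ⟨N, fun n hn => ?_⟩
  obtain ⟨hn1, hn2⟩ := hN n hn.le
  have e3 : mean n (fun m => |X n m|) ≤ mean n (fun m => min |X n m| K) + max C 0 / K := by
    calc _ ≤ mean n (fun m => min |X n m| K + K⁻¹ * X n m ^ 2) :=
          mean_mono fun m _ => by
            rw [← div_eq_inv_mul]; exact abs_le_min_add_sq_div hK _
      _ ≤ _ := by
          rw [mean_add, mean_const_mul, div_eq_inv_mul]
          gcongr
          exact hn1.trans (le_max_left _ _)
  have e4 : mean n (fun m => min |X n m| K) ≤ mean n (fun m => |X n m|) :=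
    mean_mono fun m _ => min_le_left _ _
  rw [Real.dist_eq, abs_lt] at hn2 ⊢
  constructor <;> linarith [hn2.1, hn2.2]

lemma norm_prod_sub_prod_le_sum {ι : Type*} (s : Finset ι) {a b : ι → ℂ}
    (ha : ∀ i ∈ s, ‖a i‖ ≤ 1) (hb : ∀ i ∈ s, ‖b i‖ ≤ 1) :
    ‖∏ i ∈ s, a i - ∏ i ∈ s, b i‖ ≤ ∑ i ∈ s, ‖a i - b i‖ := by
  classical
  induction s using Finset.induction_on with
  | empty => simp
  | insert i s hi ih =>
    rw [Finset.prod_insert hi, Finset.prod_insert hi, Finset.sum_insert hi]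
    have ih' := ih (fun j hj => ha j (Finset.mem_insert_of_mem hj))
      (fun j hj => hb j (Finset.mem_insert_of_mem hj))
    have h1 : ‖∏ j ∈ s, a j‖ ≤ 1 := by
      rw [norm_prod]
      exact Finset.prod_le_one (fun _ _ => norm_nonneg _)
        fun j hj => ha j (Finset.mem_insert_of_mem hj)
    have h2 := hb i (Finset.mem_insert_self i s)
    calc ‖a i * ∏ j ∈ s, a j - b i * ∏ j ∈ s, b j‖
        = ‖(a i - b i) * ∏ j ∈ s, a j + b i * (∏ j ∈ s, a j - ∏ j ∈ s, b j)‖ := by ring_nf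
      _ ≤ ‖a i - b i‖ * 1 + 1 * ‖∏ j ∈ s, a j - ∏ j ∈ s, b j‖ := by
        refine (norm_add_le _ _).trans ?_
        rw [norm_mul, norm_mul]
        gcongr
      _ ≤ _ := by linarith

lemma norm_cexp_sub_taylor_two_le {x : ℝ} (hx : |x| ≤ 1) :
    ‖Complex.exp (Complex.I * x) - 1 - (Complex.I * x - (x ^ 2 / 2 : ℝ))‖ ≤ |x| ^ 3 := by
  have h := Complex.exp_bound (x := Complex.I * x) (by simpa using hx) (n := 3) (by norm_num)
  simp only [Finset.sum_range_succ, Finset.sum_range_zero, mul_pow, Complex.I_sq, norm_mul,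
    Complex.norm_I, one_mul, Complex.norm_real, Real.norm_eq_abs] at h
  norm_num [Nat.factorial] at h
  calc _ = ‖Complex.exp (Complex.I * x) - (1 + Complex.I * x + -(x : ℂ) ^ 2 / 2)‖ := by
        push_cast; ring_nf
    _ ≤ _ := h
    _ ≤ _ := by nlinarith [pow_nonneg (abs_nonneg x) 3]

/-- Along the primes up to `exp (log n / log log n)`, the product of the local factors of the
characteristic function approximates the characteristic function. -/
lemma tendsto_mean_cexp_sub_prod {N : ℕ → ℕ}
    (hN : ∀ᶠ n in atTop, (N n : ℝ) ≤ Real.exp (Real.log n / LL n))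
    (hA : ∀ᶠ n in atTop, recipSum (primesAP 1 (N n)) ≤ 2 * LL n) (t : ℝ) {w : ℕ → ℕ → ℂ}
    (hw : ∀ n p, ‖w n p‖ ≤ |t| / √(LL n)) :
    Tendsto (fun n : ℕ => (∑ m ∈ Finset.Icc 1 n, ∏ p ∈ primesAP 1 (N n),
        (1 + if p ∣ m then w n p else 0)) / (n : ℂ) -
      ∏ p ∈ primesAP 1 (N n), (1 + w n p * (p : ℂ)⁻¹)) atTop (nhds 0) := by
  have hbound : Tendsto (fun n : ℕ => Real.exp (-(√(LL n) * (√(LL n) - 6 * |t|)))) atTop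
      (nhds 0) := by
    refine Real.tendsto_exp_neg_atTop_nhds_zero.comp ?_
    have h := Real.tendsto_sqrt_atTop.comp tendsto_LL
    exact h.atTop_mul_atTop₀ (tendsto_atTop_add_const_right _ (-(6 * |t|)) h)
  refine squeeze_zero_norm' ?_ hbound
  filter_upwards [hN, hA, eventually_ge_atTop 3, tendsto_LL.eventually_gt_atTop 0]
    with n hn hAn hn3 hL
  have hn0 : 0 < n := by omega
  have hnR : (0 : ℝ) < n := by exact_mod_cast hn0
  have hlog : 0 < Real.log n := Real.log_pos (by exact_mod_cast (by omega : 1 < n))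
  have hδ1 : LL n / Real.log n ≤ 1 := by
    rw [div_le_one hlog]
    exact (Real.log_le_sub_one_of_pos hlog).trans (by linarith)
  have hδ0 : 0 ≤ LL n / Real.log n := by positivity
  refine (norm_mean_prod_sub_le hn0 (fun p hp => prime_of_mem_primesAP hp) (w n) hδ0
    hδ1).trans ?_
  have h1 : (n : ℝ) ^ (-(LL n / Real.log n)) = Real.exp (-LL n) := by
    rw [Real.rpow_def_of_pos hnR]
    congr 1
    field_simp
  have h2 : ∏ p ∈ primesAP 1 (N n), (1 + ‖w n p‖ * (p : ℝ) ^ (LL n / Real.log n - 1)) ≤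
      Real.exp (∑ p ∈ primesAP 1 (N n), |t| / √(LL n) * (3 * (p : ℝ)⁻¹)) := by
    rw [Real.exp_sum]
    refine Finset.prod_le_prod (fun p _ => by positivity) fun p hp => ?_
    have hp0 : (0 : ℝ) < p := by exact_mod_cast (prime_of_mem_primesAP hp).pos
    have hpN : (p : ℝ) ≤ Real.exp (Real.log n / LL n) :=
      le_trans (by exact_mod_cast (Finset.mem_Icc.1 (primesAP_subset _ _ hp)).2) hn
    have hpδ : (p : ℝ) ^ (LL n / Real.log n - 1) ≤ 3 * (p : ℝ)⁻¹ := by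
      rw [Real.rpow_sub_one hp0.ne', div_eq_mul_inv]
      gcongr
      calc (p : ℝ) ^ (LL n / Real.log n)
          ≤ Real.exp (Real.log n / LL n) ^ (LL n / Real.log n) :=
            Real.rpow_le_rpow hp0.le hpN hδ0
        _ = Real.exp 1 := by
            rw [← Real.exp_mul]; congr 1; field_simp
        _ ≤ 3 := by linarith [Real.exp_one_lt_d9]
    calc _ ≤ 1 + |t| / √(LL n) * (3 * (p : ℝ)⁻¹) := by
          gcongr
          exact hw n p
      _ ≤ _ := by rw [add_comm]; exact Real.add_one_le_exp _
  calc _ ≤ Real.exp (-LL n) *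
        Real.exp (∑ p ∈ primesAP 1 (N n), |t| / √(LL n) * (3 * (p : ℝ)⁻¹)) := by
        rw [h1]; gcongr
    _ ≤ _ := by
        rw [← Real.exp_add, Real.exp_le_exp, ← Finset.mul_sum, ← Finset.mul_sum]
        change _ + |t| / √(LL n) * (3 * recipSum (primesAP 1 (N n))) ≤ _
        have hs : √(LL n) * √(LL n) = LL n := Real.mul_self_sqrt hL.le
        have hs0 : 0 < √(LL n) := Real.sqrt_pos.2 hL
        calc _ ≤ -LL n + |t| / √(LL n) * (3 * (2 * (√(LL n) * √(LL n)))) := by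
              rw [hs]; gcongr
          _ = _ := by
              field_simp
              linarith

/-- A central limit theorem for additive functions supported on small primes, in terms of
characteristic functions. -/
lemma tendsto_mean_cexp_additive {f : ℕ → ℝ} (hf : ∀ p, |f p| ≤ 1) {N : ℕ → ℕ} {v : ℝ}
    (hN : ∀ᶠ n in atTop, (N n : ℝ) ≤ Real.exp (Real.log n / LL n))
    (hA : ∀ᶠ n in atTop, recipSum (primesAP 1 (N n)) ≤ 2 * LL n)
    (h1 : Tendsto (fun n => (∑ p ∈ primesAP 1 (N n), f p * (p : ℝ)⁻¹) / √(LL n)) atTop (nhds 0))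
    (h2 : Tendsto (fun n => (∑ p ∈ primesAP 1 (N n), f p ^ 2 * (p : ℝ)⁻¹) / LL n) atTop (nhds v))
    (t : ℝ) :
    Tendsto (fun n : ℕ => (∑ m ∈ Finset.Icc 1 n, Complex.exp (t *
        (((∑ p ∈ primesAP 1 (N n), if p ∣ m then f p else 0) / √(LL n) : ℝ) : ℂ) * Complex.I)) / n)
      atTop (nhds (Complex.exp (-(v * t ^ 2 / 2)))) := by
  set τ : ℕ → ℝ := fun n => t / √(LL n) with hτ
  have hsqrt : Tendsto (fun n => √(LL n)) atTop atTop := Real.tendsto_sqrt_atTop.comp tendsto_LL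
  have hτ0 : Tendsto τ atTop (nhds 0) := hsqrt.const_div_atTop t
  set w : ℕ → ℕ → ℂ := fun n p => Complex.exp (Complex.I * (τ n * f p : ℝ)) - 1 with hw
  have hwτ : ∀ n p, ‖w n p‖ ≤ |τ n| := fun n p => by
    refine (Real.norm_exp_I_mul_ofReal_sub_one_le).trans ?_
    rw [Real.norm_eq_abs, abs_mul]
    exact mul_le_of_le_one_right (abs_nonneg _) (hf p)
  have hwt : ∀ n p, ‖w n p‖ ≤ |t| / √(LL n) := fun n p => by
    have := hwτ n p
    rwa [hτ, abs_div, abs_of_nonneg (Real.sqrt_nonneg _)] at this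
  have hmain := tendsto_mean_cexp_sub_prod hN hA t hwt
  have hprod : Tendsto (fun n => ∏ p ∈ primesAP 1 (N n), (1 + w n p * (p : ℂ)⁻¹) -
      Complex.exp (∑ p ∈ primesAP 1 (N n), w n p * (p : ℂ)⁻¹)) atTop (nhds 0) := by
    have hb : Tendsto (fun n => |τ n| ^ 2 * ∑' k : ℕ, 1 / (k : ℝ) ^ 2) atTop (nhds 0) := by
      simpa only [abs_zero, ne_eq, two_ne_zero, not_false_eq_true, zero_pow, zero_mul] using
        (hτ0.abs.pow 2).mul_const (∑' k : ℕ, 1 / (k : ℝ) ^ 2)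
    refine squeeze_zero_norm' ?_ hb
    filter_upwards [hτ0.abs.eventually_le_const (by simp : |(0 : ℝ)| < 1)] with n hn
    rw [Complex.exp_sum]
    have hp1 : ∀ p ∈ primesAP 1 (N n), (1 : ℝ) ≤ p := fun p hp => by
      exact_mod_cast (prime_of_mem_primesAP hp).pos
    have hre : ∀ p, (w n p).re ≤ 0 := fun p => by
      simp only [hw, Complex.sub_re, Complex.one_re, sub_nonpos, mul_comm Complex.I,
        Complex.exp_ofReal_mul_I_re]
      exact Real.cos_le_one _
    refine (norm_prod_sub_prod_le_sum _ (fun p hp => ?_) fun p hp => ?_).trans ?_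
    · have hp := hp1 p hp
      have : 1 + w n p * (p : ℂ)⁻¹ = ((1 - (p : ℝ)⁻¹ : ℝ) : ℂ) +
          Complex.exp ((τ n * f p : ℝ) * Complex.I) * ((p : ℝ)⁻¹ : ℝ) := by
        simp only [hw]; push_cast; ring_nf
      rw [this]
      refine (norm_add_le _ _).trans ?_
      have hpi : (p : ℝ)⁻¹ ≤ 1 := inv_le_one_of_one_le₀ hp
      rw [norm_mul, Complex.norm_exp_ofReal_mul_I, one_mul, Complex.norm_real, Complex.norm_real,
        Real.norm_of_nonneg (by linarith), Real.norm_of_nonneg (by positivity)]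
      linarith
    · rw [Complex.norm_exp, Real.exp_le_one_iff]
      have : (w n p * (p : ℂ)⁻¹).re = (w n p).re * (p : ℝ)⁻¹ := by
        rw [show (p : ℂ)⁻¹ = (((p : ℝ)⁻¹ : ℝ) : ℂ) by push_cast; rfl, Complex.re_mul_ofReal]
      rw [this]
      exact mul_nonpos_of_nonpos_of_nonneg (hre p) (by positivity)
    · calc _ ≤ ∑ p ∈ primesAP 1 (N n), |τ n| ^ 2 * (1 / (p : ℝ) ^ 2) := by
            refine Finset.sum_le_sum fun p hp => ?_
            have hp := hp1 p hp
            have hn' : ‖w n p * (p : ℂ)⁻¹‖ = ‖w n p‖ * (p : ℝ)⁻¹ := by simp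
            have hle : ‖w n p * (p : ℂ)⁻¹‖ ≤ |τ n| * (p : ℝ)⁻¹ := by
              rw [hn']; gcongr; exact hwτ n p
            rw [← norm_neg, neg_sub, show Complex.exp (w n p * (p : ℂ)⁻¹) - (1 + w n p * (p : ℂ)⁻¹)
              = Complex.exp (w n p * (p : ℂ)⁻¹) - 1 - w n p * (p : ℂ)⁻¹ by ring]
            refine (Complex.norm_exp_sub_one_sub_id_le (hle.trans ?_)).trans ?_
            · exact mul_le_one₀ hn (by positivity) (inv_le_one_of_one_le₀ hp)
            · refine (pow_le_pow_left₀ (norm_nonneg _) hle 2).trans_eq ?_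
              rw [mul_pow, one_div, inv_pow]
        _ ≤ _ := by
            rw [← Finset.mul_sum]
            gcongr
            exact Summable.sum_le_tsum _ (fun _ _ => by positivity)
              (Real.summable_one_div_nat_pow.2 one_lt_two)
  have hsum : Tendsto (fun n => ∑ p ∈ primesAP 1 (N n), w n p * (p : ℂ)⁻¹) atTop
      (nhds (-(v * t ^ 2 / 2))) := by
    have hmainterm : Tendsto (fun n => Complex.I * ((t * ((∑ p ∈ primesAP 1 (N n),
        f p * (p : ℝ)⁻¹) / √(LL n)) : ℝ) : ℂ) - ((t ^ 2 / 2 * ((∑ p ∈ primesAP 1 (N n),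
        f p ^ 2 * (p : ℝ)⁻¹) / LL n) : ℝ) : ℂ)) atTop
        (nhds (Complex.I * ((t * 0 : ℝ) : ℂ) - ((t ^ 2 / 2 * v : ℝ) : ℂ))) :=
      (((Complex.continuous_ofReal.tendsto _).comp (h1.const_mul t)).const_mul _).sub
        ((Complex.continuous_ofReal.tendsto _).comp (h2.const_mul _))
    have herr : Tendsto (fun n => ∑ p ∈ primesAP 1 (N n), w n p * (p : ℂ)⁻¹ -
        (Complex.I * ((t * ((∑ p ∈ primesAP 1 (N n),
        f p * (p : ℝ)⁻¹) / √(LL n)) : ℝ) : ℂ) - ((t ^ 2 / 2 * ((∑ p ∈ primesAP 1 (N n),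
        f p ^ 2 * (p : ℝ)⁻¹) / LL n) : ℝ) : ℂ))) atTop (nhds 0) := by
      have hb : Tendsto (fun n => |τ n| * (2 * t ^ 2)) atTop (nhds 0) := by
        simpa using hτ0.abs.mul_const (2 * t ^ 2)
      refine squeeze_zero_norm' ?_ hb
      filter_upwards [hτ0.abs.eventually_le_const (by simp : |(0 : ℝ)| < 1), hA,
        tendsto_LL.eventually_gt_atTop 0] with n hn hAn hL
      have hτL : |τ n| ^ 2 * LL n = t ^ 2 := by
        rw [hτ, sq_abs, div_pow, Real.sq_sqrt hL.le]; field_simp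
      have heq : Complex.I * ((t * ((∑ p ∈ primesAP 1 (N n),
          f p * (p : ℝ)⁻¹) / √(LL n)) : ℝ) : ℂ) - ((t ^ 2 / 2 * ((∑ p ∈ primesAP 1 (N n),
          f p ^ 2 * (p : ℝ)⁻¹) / LL n) : ℝ) : ℂ) = ∑ p ∈ primesAP 1 (N n),
          (Complex.I * (τ n * f p : ℝ) - ((τ n * f p) ^ 2 / 2 : ℝ)) * (p : ℂ)⁻¹ := by
        have e1 : t * ((∑ p ∈ primesAP 1 (N n), f p * (p : ℝ)⁻¹) / √(LL n)) =
            ∑ p ∈ primesAP 1 (N n), τ n * f p * (p : ℝ)⁻¹ := by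
          rw [mul_div_assoc', mul_div_right_comm, Finset.mul_sum]
          exact Finset.sum_congr rfl fun p _ => by rw [hτ]; ring
        have e2 : t ^ 2 / 2 * ((∑ p ∈ primesAP 1 (N n), f p ^ 2 * (p : ℝ)⁻¹) / LL n) =
            ∑ p ∈ primesAP 1 (N n), (τ n * f p) ^ 2 / 2 * (p : ℝ)⁻¹ := by
          rw [← hτL, sq_abs, mul_comm (τ n ^ 2), mul_div_assoc', Finset.mul_sum, Finset.sum_div]
          refine Finset.sum_congr rfl fun p _ => ?_
          field_simp
        rw [e1, e2]
        simp only [sub_mul, Finset.sum_sub_distrib]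
        push_cast
        rw [Finset.mul_sum]
        congr 1
        exact Finset.sum_congr rfl fun p _ => by ring
      rw [heq, ← Finset.sum_sub_distrib]
      calc _ ≤ ∑ p ∈ primesAP 1 (N n), |τ n| ^ 3 * (p : ℝ)⁻¹ := by
            refine (norm_sum_le _ _).trans (Finset.sum_le_sum fun p _ => ?_)
            rw [← sub_mul, norm_mul]
            have hle : |τ n * f p| ≤ |τ n| := by
              rw [abs_mul]; exact mul_le_of_le_one_right (abs_nonneg _) (hf p)
            have := norm_cexp_sub_taylor_two_le (hle.trans hn)
            have h3 : ‖(p : ℂ)⁻¹‖ = (p : ℝ)⁻¹ := by simp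
            rw [h3]
            gcongr
            exact this.trans (pow_le_pow_left₀ (abs_nonneg _) hle 3)
        _ = |τ n| ^ 3 * recipSum (primesAP 1 (N n)) := by rw [← Finset.mul_sum, recipSum]
        _ ≤ |τ n| ^ 3 * (2 * LL n) := by gcongr
        _ = |τ n| * (2 * (|τ n| ^ 2 * LL n)) := by ring
        _ = _ := by rw [hτL]
    have := herr.add hmainterm
    simp only [sub_add_cancel, zero_add] at this
    convert this using 2
    push_cast; ring
  have hexp := (Complex.continuous_exp.tendsto _).comp hsum
  have := (hmain.add hprod).add hexp
  simp only [sub_add_sub_cancel, add_zero, zero_add] at this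
  refine this.congr fun n => ?_
  simp only [Function.comp_apply, sub_add_cancel]
  congr 1
  refine Finset.sum_congr rfl fun m _ => ?_
  rw [show (t : ℂ) * (((∑ p ∈ primesAP 1 (N n), if p ∣ m then f p else 0) / √(LL n) : ℝ) : ℂ) *
      Complex.I = ∑ p ∈ primesAP 1 (N n), Complex.I * (τ n * (if p ∣ m then f p else 0) : ℝ) by
    rw [← Finset.mul_sum, ← Complex.ofReal_sum, ← Finset.mul_sum, hτ]
    push_cast; ring, Complex.exp_sum]
  refine Finset.prod_congr rfl fun p _ => ?_
  split_ifs <;> simp [hw]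

/-- The truncation point `exp (log n / log log n)`. -/
def cutoff (n : ℕ) : ℕ := ⌊Real.exp (Real.log n / LL n)⌋₊

lemma cutoff_le (n : ℕ) : (cutoff n : ℝ) ≤ Real.exp (Real.log n / LL n) :=
  Nat.floor_le (Real.exp_pos _).le

lemma eventually_cutoff_le : ∀ᶠ n in atTop, cutoff n ≤ n := by
  filter_upwards [tendsto_LL.eventually_ge_atTop 1, eventually_ge_atTop 1] with n hL hn
  have hn0 : (1 : ℝ) ≤ n := by exact_mod_cast hn
  have h := (cutoff_le n).trans (Real.exp_le_exp.2 (div_le_self (Real.log_nonneg hn0) hL))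
  rw [Real.exp_log (by linarith)] at h
  exact_mod_cast h

lemma tendsto_log_div_self : Tendsto (fun x : ℝ => Real.log x / x) atTop (nhds 0) :=
  Real.isLittleO_log_id_atTop.tendsto_div_nhds_zero

lemma tendsto_log_div_LL : Tendsto (fun n : ℕ => Real.log n / LL n) atTop atTop := by
  have h : Tendsto (fun x : ℝ => x / Real.log x) atTop atTop := by
    have : Tendsto (fun x : ℝ => Real.log x / x) atTop (nhdsWithin 0 (Set.Ioi 0)) := by
      refine tendsto_nhdsWithin_iff.2 ⟨tendsto_log_div_self, ?_⟩
      filter_upwards [eventually_gt_atTop 1] with x hx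
      exact div_pos (Real.log_pos hx) (by linarith)
    exact this.inv_tendsto_nhdsGT_zero.congr fun x => by simp
  exact h.comp (Real.tendsto_log_atTop.comp tendsto_natCast_atTop_atTop)

lemma tendsto_const_div_sqrt_LL (C : ℝ) : Tendsto (fun n => C / √(LL n)) atTop (nhds 0) :=
  (Real.tendsto_sqrt_atTop.comp tendsto_LL).const_div_atTop C

lemma tendsto_log_LL_div_LL : Tendsto (fun n => Real.log (LL n) / LL n) atTop (nhds 0) :=
  tendsto_log_div_self.comp tendsto_LL

lemma tendsto_log_LL_div_sqrt : Tendsto (fun n => Real.log (LL n) / √(LL n)) atTop (nhds 0) := by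
  have h := (tendsto_log_div_self.comp (Real.tendsto_sqrt_atTop.comp tendsto_LL)).const_mul 2
  rw [mul_zero] at h
  refine h.congr' ?_
  filter_upwards [tendsto_LL.eventually_gt_atTop 0] with n hL
  simp only [Function.comp_apply]
  rw [Real.log_sqrt hL.le]; ring

lemma exists_abs_recipSum_cutoff_sub_le (q : ℕ) (hq : 0 < q) :
    ∃ C, 0 ≤ C ∧ ∀ᶠ n : ℕ in atTop,
      |recipSum (primesAP q (cutoff n)) - (LL n - Real.log (LL n)) / q.totient| ≤ C := by
  obtain ⟨C, hC, h⟩ := mertens_primesAP q hq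
  refine ⟨C, hC, ?_⟩
  filter_upwards [tendsto_log_div_LL.eventually_ge_atTop 2, tendsto_LL.eventually_gt_atTop 0,
    eventually_ge_atTop 3] with n hn hL hn3
  have hlog : 0 < Real.log n := Real.log_pos (by exact_mod_cast (by omega : 1 < n))
  have := h _ (Real.exp_le_exp.2 hn)
  rwa [Real.log_exp, Real.log_div hlog.ne' hL.ne'] at this

lemma tendsto_recipSum_cutoff_div (q : ℕ) (hq : 0 < q) :
    Tendsto (fun n => recipSum (primesAP q (cutoff n)) / LL n) atTop
      (nhds (q.totient : ℝ)⁻¹) := by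
  obtain ⟨C, -, h⟩ := exists_abs_recipSum_cutoff_sub_le q hq
  have h1 : Tendsto (fun n => (1 - Real.log (LL n) / LL n) / q.totient) atTop
      (nhds (q.totient : ℝ)⁻¹) := by
    simpa using (tendsto_log_LL_div_LL.const_sub 1).div_const (q.totient : ℝ)
  have h2 : Tendsto (fun n => recipSum (primesAP q (cutoff n)) / LL n -
      (1 - Real.log (LL n) / LL n) / q.totient) atTop (nhds 0) := by
    refine squeeze_zero_norm' ?_ (tendsto_LL.const_div_atTop C)
    filter_upwards [h, tendsto_LL.eventually_gt_atTop 0] with n hn hL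
    have : recipSum (primesAP q (cutoff n)) / LL n - (1 - Real.log (LL n) / LL n) / q.totient =
        (recipSum (primesAP q (cutoff n)) - (LL n - Real.log (LL n)) / q.totient) / LL n := by
      field_simp
    rw [this, Real.norm_eq_abs, abs_div, abs_of_pos hL]
    gcongr
  simpa using h2.add h1

lemma primesAP_mono (q : ℕ) {k n : ℕ} (h : k ≤ n) : primesAP q k ⊆ primesAP q n :=
  Finset.filter_subset_filter _ (Finset.Icc_subset_Icc_right h)

lemma divCount_sub_divCount {P P' : Finset ℕ} (h : P ⊆ P') (m : ℕ) :
    (divCount P' m : ℝ) - divCount P m = divCount (P' \ P) m := by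
  rw [divCount_eq_sum, divCount_eq_sum, divCount_eq_sum, ← Finset.sum_sdiff h, add_sub_cancel_right]

/-- Discarding the primes beyond the cutoff changes `ω(m; q, 1)` negligibly on average. -/
lemma tendsto_mean_divCount_sub_cutoff (q : ℕ) (hq : 0 < q) :
    Tendsto (fun n => mean n (fun m => |(divCount (primesAP q n) m : ℝ) -
      divCount (primesAP q (cutoff n)) m|) / √(LL n)) atTop (nhds 0) := by
  obtain ⟨C, -, h⟩ := exists_abs_recipSum_sub_le q hq
  obtain ⟨C', -, h'⟩ := exists_abs_recipSum_cutoff_sub_le q hq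
  have hb : Tendsto (fun n => (q.totient : ℝ)⁻¹ * (Real.log (LL n) / √(LL n)) +
      (C + C') / √(LL n)) atTop (nhds 0) := by
    simpa using (tendsto_log_LL_div_sqrt.const_mul _).add (tendsto_const_div_sqrt_LL (C + C'))
  refine squeeze_zero' (.of_forall fun n => div_nonneg (mean_nonneg fun _ => abs_nonneg _)
    (Real.sqrt_nonneg _)) ?_ hb
  filter_upwards [h, h', eventually_cutoff_le, eventually_gt_atTop 0] with n hn hn' hc hn0
  have hsub := primesAP_mono q hc
  have : mean n (fun m => |(divCount (primesAP q n) m : ℝ) -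
      divCount (primesAP q (cutoff n)) m|) ≤
      recipSum (primesAP q n) - recipSum (primesAP q (cutoff n)) := by
    simp_rw [divCount_sub_divCount hsub, Nat.abs_cast]
    refine (mean_divCount_le hn0 _).trans_eq ?_
    rw [recipSum, recipSum, recipSum, ← Finset.sum_sdiff hsub, add_sub_cancel_right]
  rw [mul_div_assoc', ← add_div]
  gcongr
  have e : (LL n - Real.log (LL n)) / (q.totient : ℝ) =
    LL n / q.totient - (q.totient : ℝ)⁻¹ * Real.log (LL n) := by ring
  rw [e] at hn'
  linarith [(abs_le.1 hn).2, (abs_le.1 hn').1]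

/-- The asymptotic variance of the difference of two independent prime counts of equal density. -/
def pairVar (φ : ℕ) : NNReal := NNReal.mk (2 * (φ : ℝ)⁻¹ * (1 - (φ : ℝ)⁻¹)) <| by
  have : (φ : ℝ)⁻¹ ≤ 1 := Nat.cast_inv_le_one φ
  have h0 : 0 ≤ (φ : ℝ)⁻¹ := by positivity
  nlinarith

lemma sum_primesAP_one_eq (q N : ℕ) (g : ℕ → ℝ) :
    ∑ p ∈ primesAP 1 N, (if p % q = 1 % q then g p else 0) = ∑ p ∈ primesAP q N, g p := by
  rw [← Finset.sum_filter]
  congr 1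
  ext p
  simp [primesAP, Nat.mod_one, and_assoc]

lemma tendsto_mean_abs_divCount_cutoff_sub {q₁ q₂ : ℕ} (h₁ : 0 < q₁) (h₂ : 0 < q₂)
    (hcop : q₁.Coprime q₂) (hφ : q₁.totient = q₂.totient) :
    Tendsto (fun n => mean n (fun m => |((divCount (primesAP q₁ (cutoff n)) m : ℝ) -
      divCount (primesAP q₂ (cutoff n)) m) / √(LL n)|)) atTop
      (nhds (√(pairVar q₂.totient) * √(2 / Real.pi))) := by
  obtain ⟨C₁, -, hC₁⟩ := exists_abs_recipSum_cutoff_sub_le q₁ h₁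
  obtain ⟨C₂, -, hC₂⟩ := exists_abs_recipSum_cutoff_sub_le q₂ h₂
  have hdiff : ∀ᶠ n in atTop, |recipSum (primesAP q₁ (cutoff n)) -
      recipSum (primesAP q₂ (cutoff n))| ≤ C₁ + C₂ := by
    filter_upwards [hC₁, hC₂] with n h1 h2
    rw [hφ] at h1
    rw [abs_le] at *
    constructor <;> linarith
  set ind : ℕ → ℕ → ℝ := fun q p => if p % q = 1 % q then 1 else 0 with hind
  have hind_mul : ∀ q N (g : ℕ → ℝ), ∑ p ∈ primesAP 1 N, ind q p * g p =
      ∑ p ∈ primesAP q N, g p := fun q N g => by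
    rw [← sum_primesAP_one_eq q]
    exact Finset.sum_congr rfl fun p _ => by simp [hind]
  have hfsq : ∀ p, (ind q₁ p - ind q₂ p) ^ 2 = ind q₁ p + ind q₂ p - 2 * ind (q₁ * q₂) p := by
    intro p
    have : p % (q₁ * q₂) = 1 % (q₁ * q₂) ↔ p % q₁ = 1 % q₁ ∧ p % q₂ = 1 % q₂ :=
      (Nat.modEq_and_modEq_iff_modEq_mul hcop).symm
    simp only [hind, this]
    by_cases a : p % q₁ = 1 % q₁ <;> by_cases b : p % q₂ = 1 % q₂ <;> norm_num [a, b]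
  refine tendsto_mean_abs_of_tendsto_charFun (C := 27 * ((q₁.totient : ℝ)⁻¹ +
    (q₂.totient : ℝ)⁻¹ + 2) + 3 * (C₁ + C₂) ^ 2) (fun t => ?_) ?_
  · refine (tendsto_mean_cexp_additive (f := fun p => ind q₁ p - ind q₂ p) (N := cutoff)
      (v := pairVar q₂.totient) (fun p => ?_) (.of_forall cutoff_le) ?_ ?_ ?_ t).congr fun n => ?_
    · simp only [hind]
      split_ifs <;> simp
    · have h := tendsto_recipSum_cutoff_div 1 one_pos
      simp only [Nat.totient_one, Nat.cast_one, inv_one] at h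
      filter_upwards [h.eventually_le_const one_lt_two, tendsto_LL.eventually_gt_atTop 0]
        with n hn hL
      rwa [div_le_iff₀ hL] at hn
    · refine squeeze_zero_norm' ?_ (tendsto_const_div_sqrt_LL (C₁ + C₂))
      filter_upwards [hdiff] with n hn
      simp only [sub_mul, Finset.sum_sub_distrib, hind_mul]
      rw [Real.norm_eq_abs, abs_div, abs_of_nonneg (Real.sqrt_nonneg _)]
      gcongr
      exact hn
    · have h := ((tendsto_recipSum_cutoff_div q₁ h₁).add (tendsto_recipSum_cutoff_div q₂ h₂)).sub
        ((tendsto_recipSum_cutoff_div (q₁ * q₂) (by positivity)).const_mul 2)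
      have e : ((q₁.totient : ℝ)⁻¹ + (q₂.totient : ℝ)⁻¹ - 2 * ((q₁ * q₂).totient : ℝ)⁻¹) =
          (pairVar q₂.totient : ℝ) := by
        rw [Nat.totient_mul hcop, hφ, pairVar, NNReal.coe_mk]
        push_cast
        rw [mul_inv]; ring
      rw [e] at h
      refine h.congr fun n => ?_
      simp only [hfsq, sub_mul, add_mul, Finset.sum_sub_distrib, Finset.sum_add_distrib, hind_mul,
        mul_assoc, ← Finset.mul_sum]
      simp only [recipSum]
      ring
    · congr 1
      refine Finset.sum_congr rfl fun m _ => ?_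
      have : (∑ p ∈ primesAP 1 (cutoff n), if p ∣ m then ind q₁ p - ind q₂ p else 0) =
          (divCount (primesAP q₁ (cutoff n)) m : ℝ) - divCount (primesAP q₂ (cutoff n)) m := by
        rw [divCount_eq_sum, divCount_eq_sum, ← hind_mul q₁, ← hind_mul q₂, ← Finset.sum_sub_distrib]
        refine Finset.sum_congr rfl fun p _ => ?_
        split_ifs <;> simp
      rw [this]
  · filter_upwards [hdiff, eventually_cutoff_le, eventually_gt_atTop 0,
      (tendsto_recipSum_cutoff_div q₁ h₁).eventually_le_const (lt_add_one _),
      (tendsto_recipSum_cutoff_div q₂ h₂).eventually_le_const (lt_add_one _),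
      tendsto_LL.eventually_ge_atTop 1] with n hd hc hn hA₁ hA₂ hL
    have hL0 : 0 < LL n := by linarith
    have hsub : ∀ q, primesAP q (cutoff n) ⊆ Finset.Icc 1 n := fun q =>
      (primesAP_subset _ _).trans (Finset.Icc_subset_Icc_right hc)
    have t₁ := mean_divCount_sub_sq_le hn (fun p hp => prime_of_mem_primesAP hp) (hsub q₁)
    have t₂ := mean_divCount_sub_sq_le hn (fun p hp => prime_of_mem_primesAP hp) (hsub q₂)
    set A₁ := recipSum (primesAP q₁ (cutoff n))
    set A₂ := recipSum (primesAP q₂ (cutoff n))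
    rw [div_le_iff₀ hL0] at hA₁ hA₂
    calc _ ≤ mean n (fun m => (3 / LL n) * ((((divCount (primesAP q₁ (cutoff n)) m : ℝ) - A₁) ^ 2 +
          ((divCount (primesAP q₂ (cutoff n)) m : ℝ) - A₂) ^ 2) + (C₁ + C₂) ^ 2)) := by
          refine mean_mono fun m _ => ?_
          rw [div_pow, Real.sq_sqrt hL0.le, div_mul_eq_mul_div]
          gcongr
          have hd2 : (A₁ - A₂) ^ 2 ≤ (C₁ + C₂) ^ 2 := sq_le_sq' (by linarith [(abs_le.1 hd).1])
            (abs_le.1 hd).2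
          set x := (divCount (primesAP q₁ (cutoff n)) m : ℝ)
          set y := (divCount (primesAP q₂ (cutoff n)) m : ℝ)
          nlinarith [sq_nonneg ((x - A₁) + (y - A₂)), sq_nonneg ((x - A₁) - (A₁ - A₂)),
            sq_nonneg ((y - A₂) + (A₁ - A₂))]
      _ ≤ (3 / LL n) * (3 * (((q₁.totient : ℝ)⁻¹ + 1) * LL n) +
          3 * (((q₂.totient : ℝ)⁻¹ + 1) * LL n) + (C₁ + C₂) ^ 2 * LL n) := by
          rw [mean_const_mul, mean_add, mean_add, mean_const hn]
          gcongr
          · exact t₁.trans (by gcongr)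
          · exact t₂.trans (by gcongr)
          · exact le_mul_of_one_le_right (sq_nonneg _) hL
      _ = 9 * ((q₁.totient : ℝ)⁻¹ + (q₂.totient : ℝ)⁻¹ + 2) + 3 * (C₁ + C₂) ^ 2 := by
          field_simp; ring
      _ ≤ _ := by
          gcongr
          norm_num

/-- The first absolute moment of `ω(m; q₁, 1) - ω(m; q₂, 1)`. -/
lemma tendsto_mean_abs_divCount_sub {q₁ q₂ : ℕ} (h₁ : 0 < q₁) (h₂ : 0 < q₂)
    (hcop : q₁.Coprime q₂) (hφ : q₁.totient = q₂.totient) :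
    Tendsto (fun n => mean n (fun m => |(divCount (primesAP q₁ n) m : ℝ) -
      divCount (primesAP q₂ n) m|) / √(LL n)) atTop
      (nhds (√(pairVar q₂.totient) * √(2 / Real.pi))) := by
  have hmain := tendsto_mean_abs_divCount_cutoff_sub h₁ h₂ hcop hφ
  have herr : Tendsto (fun n => mean n (fun m => |(divCount (primesAP q₁ n) m : ℝ) -
      divCount (primesAP q₂ n) m|) / √(LL n) -
      mean n (fun m => |((divCount (primesAP q₁ (cutoff n)) m : ℝ) -
      divCount (primesAP q₂ (cutoff n)) m) / √(LL n)|)) atTop (nhds 0) := by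
    have hb := (tendsto_mean_divCount_sub_cutoff q₁ h₁).add
      (tendsto_mean_divCount_sub_cutoff q₂ h₂)
    rw [add_zero] at hb
    refine squeeze_zero_norm (fun n => ?_) hb
    have e : mean n (fun m => |((divCount (primesAP q₁ (cutoff n)) m : ℝ) -
        divCount (primesAP q₂ (cutoff n)) m) / √(LL n)|) =
        mean n (fun m => |((divCount (primesAP q₁ (cutoff n)) m : ℝ) -
        divCount (primesAP q₂ (cutoff n)) m)|) / √(LL n) := by
      simp_rw [abs_div, abs_of_nonneg (Real.sqrt_nonneg (LL n)), div_eq_inv_mul]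
      rw [mean_const_mul]
    rw [e, ← sub_div, ← add_div, Real.norm_eq_abs, abs_div, abs_of_nonneg (Real.sqrt_nonneg _),
      ← mean_sub, ← mean_add]
    gcongr
    refine (abs_mean_le _ _).trans (mean_mono fun m _ => ?_)
    refine (abs_abs_sub_abs_le_abs_sub _ _).trans ?_
    rw [sub_sub_sub_comm]
    exact abs_sub _ _
  simpa using herr.add hmain

lemma nonempty_zmod_prod_addEquiv_lcm_gcd {q : ℕ} (hq : q = 1 ∨ IsPrimePow q) {H : ℕ}
    (hH : 0 < H) :
    Nonempty (ZMod q × ZMod H ≃+ ZMod (q.lcm H) × ZMod (q.gcd H)) := by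
  rcases hq with rfl | hq
  · rw [Nat.lcm_one_left, Nat.gcd_one_left]
    exact ⟨AddEquiv.prodComm⟩
  obtain ⟨p, k, hp, -, rfl⟩ := (isPrimePow_nat_iff _).1 hq
  obtain ⟨e, h, hph, rfl⟩ := Nat.exists_eq_pow_mul_and_not_dvd hH.ne' p hp.ne_one
  have hcop : ∀ j, (p ^ j).Coprime h := fun j =>
    Nat.Coprime.pow_left j ((Nat.Prime.coprime_iff_not_dvd hp).2 hph)
  rcases le_total k e with hke | hke
  · have hdvd : p ^ k ∣ p ^ e * h := (pow_dvd_pow p hke).mul_right h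
    rw [Nat.lcm_eq_right hdvd, Nat.gcd_eq_left hdvd]
    exact ⟨AddEquiv.prodComm⟩
  · have hgcd : (p ^ k).gcd (p ^ e * h) = p ^ e := by
      rw [Nat.Coprime.gcd_mul_right_cancel_right _ (hcop k).symm]
      exact Nat.gcd_eq_right (pow_dvd_pow p hke)
    have hlcm : (p ^ k).lcm (p ^ e * h) = p ^ k * h := by
      rw [Nat.lcm, hgcd, mul_left_comm, Nat.mul_div_cancel_left _ (pow_pos hp.pos e)]
    rw [hgcd, hlcm]
    let c₁ := (ZMod.chineseRemainder (hcop e)).toAddEquiv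
    let c₂ := (ZMod.chineseRemainder (hcop k)).toAddEquiv
    exact ⟨((AddEquiv.refl _).prodCongr (c₁.trans AddEquiv.prodComm)).trans
      (AddEquiv.prodAssoc.symm.trans (c₂.symm.prodCongr (AddEquiv.refl _)))⟩

/-- A cyclic group of prime power order can be merged into a product of cyclic groups whose orders
form a descending divisibility chain. -/
lemma exists_insert_chain (K : ℕ) (lam : Fin K → ℕ) (hlam : ∀ j, 1 < lam j)
    (hdvd : ∀ j k : Fin K, j ≤ k → lam k ∣ lam j) {q : ℕ} (hq : q = 1 ∨ IsPrimePow q) :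
    ∃ (K' : ℕ) (lam' : Fin K' → ℕ), (∀ j, 1 < lam' j) ∧
      (∀ j k : Fin K', j ≤ k → lam' k ∣ lam' j) ∧
      (∀ c, q ∣ c → (∀ j, lam j ∣ c) → ∀ j, lam' j ∣ c) ∧
      Nonempty (ZMod q × (∀ j, ZMod (lam j)) ≃+ ∀ j, ZMod (lam' j)) := by
  induction K generalizing q with
  | zero =>
    rcases hq with rfl | hq
    · exact ⟨0, lam, hlam, hdvd, fun _ _ h => h, ⟨AddEquiv.uniqueProd⟩⟩
    · refine ⟨1, fun _ => q, fun _ => hq.one_lt, fun _ _ _ => dvd_rfl, fun c h _ _ => h, ⟨?_⟩⟩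
      exact AddEquiv.prodUnique.trans (RingEquiv.piUnique fun _ : Fin 1 => ZMod q).symm.toAddEquiv
  | succ K ih =>
    rcases eq_or_ne q 1 with rfl | hq1
    · exact ⟨K + 1, lam, hlam, hdvd, fun _ _ h => h, ⟨AddEquiv.uniqueProd⟩⟩
    have hg : q.gcd (lam 0) = 1 ∨ IsPrimePow (q.gcd (lam 0)) := by
      rcases eq_or_ne (q.gcd (lam 0)) 1 with h | h
      · exact .inl h
      · exact .inr ((hq.resolve_left hq1).dvd (Nat.gcd_dvd_left _ _) h)
    obtain ⟨K', lam', h1, h2, h3, ⟨e⟩⟩ := ih (fun j => lam j.succ) (fun j => hlam _)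
      (fun j k h => hdvd _ _ (Fin.succ_le_succ_iff.2 h)) hg
    obtain ⟨e₀⟩ := nonempty_zmod_prod_addEquiv_lcm_gcd hq (H := lam 0) (by linarith [hlam 0])
    have hL : ∀ j, lam' j ∣ q.lcm (lam 0) := h3 _ ((Nat.gcd_dvd_left _ _).trans
      (Nat.dvd_lcm_left _ _)) fun j => (hdvd 0 j.succ (Fin.zero_le _)).trans (Nat.dvd_lcm_right _ _)
    have hq0 : 0 < q := (hq.resolve_left hq1).pos
    refine ⟨K' + 1, Fin.cons (q.lcm (lam 0)) lam', ?_, ?_, ?_, ⟨?_⟩⟩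
    · refine Fin.cases ?_ fun j => ?_
      · rw [Fin.cons_zero]
        exact (hlam 0).trans_le (Nat.le_of_dvd (Nat.lcm_pos hq0 (by linarith [hlam 0]))
          (Nat.dvd_lcm_right _ _))
      · rw [Fin.cons_succ]; exact h1 j
    · intro j k hjk
      induction j using Fin.cases with
      | zero =>
        induction k using Fin.cases with
        | zero => exact dvd_rfl
        | succ k => simpa using hL k
      | succ j =>
        induction k using Fin.cases with
        | zero => simp at hjk
        | succ k => simpa using h2 j k (by simpa using hjk)
    · intro c hqc hc
      refine Fin.cases ?_ fun j => ?_
      · exact Nat.lcm_dvd hqc (hc 0)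
      · simpa using h3 c ((Nat.gcd_dvd_left _ _).trans hqc) (fun j => hc _) j
    · let c₁ := (Fin.consLinearEquiv ℤ fun j => ZMod (lam j)).symm.toAddEquiv
      let c₂ : (ZMod (q.lcm (lam 0)) × ∀ j, ZMod (lam' j)) ≃+
          ∀ j, ZMod ((Fin.cons (q.lcm (lam 0)) lam' : Fin (K' + 1) → ℕ) j) :=
        (Fin.consLinearEquiv ℤ fun j =>
          ZMod ((Fin.cons (q.lcm (lam 0)) lam' : Fin (K' + 1) → ℕ) j)).toAddEquiv
      exact ((AddEquiv.refl _).prodCongr c₁).trans (AddEquiv.prodAssoc.symm.trans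
        ((e₀.prodCongr (AddEquiv.refl _)).trans (AddEquiv.prodAssoc.trans
          (((AddEquiv.refl _).prodCongr e).trans c₂))))

lemma exists_descending_chain (k : ℕ) (q : Fin k → ℕ) (hq : ∀ i, q i = 1 ∨ IsPrimePow (q i)) :
    ∃ (K : ℕ) (lam : Fin K → ℕ), (∀ j, 1 < lam j) ∧ (∀ j k : Fin K, j ≤ k → lam k ∣ lam j) ∧
      Nonempty ((∀ i, ZMod (q i)) ≃+ ∀ j, ZMod (lam j)) := by
  induction k with
  | zero => exact ⟨0, q, fun j => j.elim0, fun j => j.elim0, ⟨AddEquiv.refl _⟩⟩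
  | succ k ih =>
    obtain ⟨K, lam, h1, h2, ⟨e⟩⟩ := ih (fun i => q i.succ) fun i => hq _
    obtain ⟨K', lam', h1', h2', -, ⟨e'⟩⟩ := exists_insert_chain K lam h1 h2 (hq 0)
    let c := (Fin.consLinearEquiv ℤ fun j => ZMod (q j)).symm.toAddEquiv
    exact ⟨K', lam', h1', h2', ⟨c.trans (((AddEquiv.refl _).prodCongr e).trans e')⟩⟩

/-- Existence of the invariant factor decomposition of a finite abelian group. -/
theorem exists_invariant_factors (G : Type*) [CommGroup G] [Finite G] :
    ∃ (K : ℕ) (lam : Fin K → ℕ), (∀ j, 1 < lam j) ∧ (∀ j k : Fin K, j ≤ k → lam j ∣ lam k) ∧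
      Nonempty (G ≃* Multiplicative (∀ j : Fin K, ZMod (lam j))) := by
  classical
  obtain ⟨ι, _, p, hp, e, ⟨E⟩⟩ := AddCommGroup.equiv_directSum_zmod_of_finite (Additive G)
  let σ := Fintype.equivFin ι
  obtain ⟨K, lam, h1, h2, ⟨E'⟩⟩ := exists_descending_chain (Fintype.card ι)
    (fun i => p (σ.symm i) ^ e (σ.symm i)) fun i => by
      rcases eq_or_ne (e (σ.symm i)) 0 with h | h
      · simp [h]
      · exact .inr ((hp _).isPrimePow.pow h)
  refine ⟨K, fun j => lam j.rev, fun j => h1 _, fun j k h => h2 _ _ (Fin.rev_le_rev.2 h), ⟨?_⟩⟩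
  let c₁ := (RingEquiv.piCongrLeft (fun i => ZMod (p i ^ e i)) σ.symm).symm.toAddEquiv
  let c₂ := (RingEquiv.piCongrLeft (fun j => ZMod (lam j)) Fin.revPerm).symm.toAddEquiv
  exact AddEquiv.toMultiplicativeRight
    (E.trans ((DirectSum.addEquivProd _).trans (c₁.trans (E'.trans c₂))))

/-- The number of elements of `G` killed by `k`. -/
def torsCard (G : Type*) [CommGroup G] (k : ℕ) : ℕ := Nat.card {x : G // x ^ k = 1}

lemma torsCard_pos (G : Type*) [CommGroup G] [Finite G] (k : ℕ) : 0 < torsCard G k :=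
  Nat.card_pos_iff.2 ⟨⟨1, one_pow k⟩, inferInstance⟩

lemma torsCard_congr {G H : Type*} [CommGroup G] [CommGroup H] (e : G ≃* H) (k : ℕ) :
    torsCard G k = torsCard H k :=
  Nat.card_congr (e.toEquiv.subtypeEquiv fun x => by
    rw [MulEquiv.toEquiv_eq_coe, EquivLike.coe_coe, ← map_pow, map_eq_one_iff _ e.injective])

lemma torsCard_prod (G H : Type*) [CommGroup G] [CommGroup H] (k : ℕ) :
    torsCard (G × H) k = torsCard G k * torsCard H k := by
  rw [torsCard, torsCard, torsCard, ← Nat.card_prod]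
  exact Nat.card_congr ((Equiv.subtypeEquivRight fun x => by simp [Prod.ext_iff]).trans
    Equiv.subtypeProdEquivProd)

lemma torsCard_of_isCyclic (G : Type*) [CommGroup G] [IsCyclic G] [Finite G] (k : ℕ) :
    torsCard G k = (Nat.card G).gcd k :=
  IsCyclic.card_powMonoidHom_ker (G := G) k

lemma torsCard_multiplicative_pi {K : ℕ} (lam : Fin K → ℕ) (hlam : ∀ j, 1 < lam j) (k : ℕ) :
    torsCard (Multiplicative (∀ j, ZMod (lam j))) k = ∏ j, (lam j).gcd k := by
  have h (j : Fin K) : torsCard (Multiplicative (ZMod (lam j))) k = (lam j).gcd k := by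
    have : NeZero (lam j) := ⟨by linarith [hlam j]⟩
    rw [torsCard_of_isCyclic]
    simp
  simp_rw [← h, torsCard]
  rw [← Nat.card_pi]
  refine Nat.card_congr (Equiv.trans (Equiv.subtypeEquivRight fun x => ?_)
    (Equiv.subtypePiEquivPi (p := fun (j : Fin K) (x : Multiplicative (ZMod (lam j))) =>
      x ^ k = 1)))
  exact funext_iff

/-- `G` has `r` cyclic factors of order divisible by `p ^ (a + 1)`. -/
def HasRank (G : Type*) [CommGroup G] (p a r : ℕ) : Prop :=
  torsCard G (p ^ (a + 1)) = p ^ r * torsCard G (p ^ a)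

lemma HasRank.unique {G : Type*} [CommGroup G] [Finite G] {p a r s : ℕ} (hp : 1 < p)
    (hr : HasRank G p a r) (hs : HasRank G p a s) : r = s :=
  Nat.pow_right_injective hp
    (Nat.eq_of_mul_eq_mul_right (torsCard_pos G (p ^ a)) (hr.symm.trans hs))

lemma HasRank.congr {G H : Type*} [CommGroup G] [CommGroup H] (e : G ≃* H) {p a r : ℕ}
    (h : HasRank G p a r) : HasRank H p a r := by
  rwa [HasRank, ← torsCard_congr e, ← torsCard_congr e]

lemma HasRank.prod {G H : Type*} [CommGroup G] [CommGroup H] {p a r s : ℕ}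
    (hG : HasRank G p a r) (hH : HasRank H p a s) : HasRank (G × H) p a (r + s) := by
  rw [HasRank] at *
  rw [torsCard_prod, torsCard_prod, hG, hH]
  ring

lemma gcd_prime_pow_succ {p : ℕ} (hp : p.Prime) (a n : ℕ) :
    n.gcd (p ^ (a + 1)) = (if p ^ (a + 1) ∣ n then p else 1) * n.gcd (p ^ a) := by
  split_ifs with h
  · rw [Nat.gcd_eq_right h, Nat.gcd_eq_right ((pow_dvd_pow p a.le_succ).trans h), pow_succ']
  · rw [one_mul]
    refine Nat.dvd_antisymm ?_ (Nat.gcd_dvd_gcd_of_dvd_right _ (pow_dvd_pow p a.le_succ))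
    refine Nat.dvd_gcd (Nat.gcd_dvd_left _ _) ?_
    obtain ⟨k, hk, hk'⟩ := (Nat.dvd_prime_pow hp).1 (Nat.gcd_dvd_right n (p ^ (a + 1)))
    rw [hk']
    refine pow_dvd_pow p (Nat.le_of_lt_succ (lt_of_le_of_ne hk ?_))
    rintro rfl
    exact h (hk' ▸ Nat.gcd_dvd_left _ _)

lemma hasRank_multiplicative_pi {K : ℕ} (lam : Fin K → ℕ) (hlam : ∀ j, 1 < lam j) {p : ℕ}
    (hp : p.Prime) (a : ℕ) :
    HasRank (Multiplicative (∀ j, ZMod (lam j))) p a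
      (Finset.univ.filter fun j => p ^ (a + 1) ∣ lam j).card := by
  rw [HasRank, torsCard_multiplicative_pi lam hlam, torsCard_multiplicative_pi lam hlam]
  simp_rw [gcd_prime_pow_succ hp a, Finset.prod_mul_distrib, Finset.prod_ite]
  simp

lemma hasRank_of_isCyclic (G : Type*) [CommGroup G] [IsCyclic G] [Finite G] {p : ℕ}
    (hp : p.Prime) (a : ℕ) : HasRank G p a (if p ^ (a + 1) ∣ Nat.card G then 1 else 0) := by
  rw [HasRank, torsCard_of_isCyclic, torsCard_of_isCyclic, gcd_prime_pow_succ hp]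
  split_ifs <;> simp

lemma exists_hasRank (G : Type*) [CommGroup G] [Finite G] {p : ℕ} (hp : p.Prime) (a : ℕ) :
    ∃ r s, HasRank G p a r ∧ r ≤ s ∧ HasRank G p 0 s := by
  obtain ⟨K, lam, h, -, ⟨e⟩⟩ := exists_invariant_factors G
  refine ⟨_, _, (hasRank_multiplicative_pi lam h hp a).congr e.symm,
    Finset.card_le_card ?_, (hasRank_multiplicative_pi lam h hp 0).congr e.symm⟩
  refine Finset.monotone_filter_right _ fun j _ hj => ?_
  exact (pow_dvd_pow p (by omega)).trans hj

lemma sq_eq_one_zmod_two_pow {k : ℕ} (x : ZMod (2 ^ (k + 2))) (hx : x ^ 2 = 1) :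
    x = 1 ∨ x = -1 ∨ x = 1 + 2 ^ (k + 1) ∨ x = -1 + 2 ^ (k + 1) := by
  obtain ⟨z, rfl⟩ := ZMod.intCast_surjective x
  have hz : (2 ^ (k + 2) : ℤ) ∣ z ^ 2 - 1 := by
    have := (ZMod.intCast_zmod_eq_zero_iff_dvd (z ^ 2 - 1) (2 ^ (k + 2)))
    push_cast at this
    exact this.1 (by rw [hx, sub_self])
  have hodd : Odd z := by
    by_contra h
    rw [Int.not_odd_iff_even] at h
    have h2 : (2 : ℤ) ∣ z ^ 2 - 1 := (dvd_pow_self 2 (by omega)).trans hz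
    have := (dvd_sub_right ((Int.even_pow' (n := 2) (by norm_num)).2 h).two_dvd).1 h2
    norm_num at this
  obtain ⟨y, rfl⟩ := hodd
  have hy : (2 ^ k : ℤ) ∣ y * (y + 1) := by
    have : (2 * y + 1) ^ 2 - 1 = 2 ^ 2 * (y * (y + 1)) := by ring
    rw [this, pow_add, mul_comm] at hz
    exact (mul_dvd_mul_iff_left (by norm_num)).1 hz
  have h0 : (2 : ZMod (2 ^ (k + 2))) ^ (k + 2) = 0 := by
    have := ZMod.natCast_self (2 ^ (k + 2))
    rwa [Nat.cast_pow] at this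
  have key (y : ℤ) (h : (2 ^ k : ℤ) ∣ y) :
      (2 * y : ZMod (2 ^ (k + 2))) = 0 ∨ (2 * y : ZMod (2 ^ (k + 2))) = 2 ^ (k + 1) := by
    obtain ⟨t, rfl⟩ := h
    obtain ⟨u, rfl | rfl⟩ := Int.even_or_odd' t
    · left
      push_cast
      linear_combination (u : ZMod (2 ^ (k + 2))) * h0
    · right
      push_cast
      linear_combination (u : ZMod (2 ^ (k + 2))) * h0
  have hcop (t : ℤ) (ht : Odd t) : IsCoprime (2 ^ k : ℤ) t :=
    (Int.isCoprime_two_left.2 ht).pow_left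
  rcases Int.even_or_odd y with he | ho
  · rcases key y ((hcop _ he.add_one).dvd_of_dvd_mul_right hy) with h | h
    · left
      push_cast
      linear_combination h
    · right; right; left
      push_cast
      linear_combination h
  · rcases key (y + 1) ((hcop _ ho).dvd_of_dvd_mul_left hy) with h | h
    · right; left
      push_cast at h ⊢
      linear_combination h
    · right; right; right
      push_cast at h ⊢
      linear_combination h

lemma torsCard_units_two_pow_le (k : ℕ) : torsCard (ZMod (2 ^ k))ˣ 2 ≤ 4 := by
  classical
  rcases lt_or_ge k 2 with hk | hk
  · refine (Finite.card_subtype_le _).trans ?_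
    rw [Nat.card_eq_fintype_card, ZMod.card_units_eq_totient]
    exact (Nat.totient_le _).trans (Nat.pow_le_pow_right two_pos hk.le)
  obtain ⟨k, rfl⟩ := Nat.exists_eq_add_of_le' hk
  let S : Finset (ZMod (2 ^ (k + 2))) := {1, -1, 1 + 2 ^ (k + 1), -1 + 2 ^ (k + 1)}
  have hS : S.card ≤ 4 := Finset.card_le_four
  refine le_trans ?_ hS
  rw [← Nat.card_eq_finsetCard S, torsCard]
  have hmem (x : {x : (ZMod (2 ^ (k + 2)))ˣ // x ^ 2 = 1}) :
      (x.1 : ZMod (2 ^ (k + 2))) ∈ S := by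
    simpa [S] using sq_eq_one_zmod_two_pow _ (congrArg Units.val x.2)
  refine Nat.card_le_card_of_injective (fun x => (⟨_, hmem x⟩ : S)) fun x y h => ?_
  exact Subtype.ext (Units.ext (congrArg Subtype.val h))

lemma torsCard_eq_one {G : Type*} [CommGroup G] [Finite G] {k : ℕ}
    (h : (Nat.card G).Coprime k) : torsCard G k = 1 := by
  rw [torsCard, Nat.card_eq_one_iff_exists]
  refine ⟨⟨1, one_pow k⟩, fun x => Subtype.ext ?_⟩
  have h1 : orderOf x.1 ∣ (Nat.card G).gcd k :=
    Nat.dvd_gcd (orderOf_dvd_natCard _) (orderOf_dvd_of_pow_eq_one x.2)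
  rw [h] at h1
  exact orderOf_eq_one_iff.1 (Nat.dvd_one.1 h1)

lemma mod_eq_one_mod_iff {q l : ℕ} (hl : 0 < l) : l % q = 1 % q ↔ q ∣ l - 1 :=
  ⟨fun h => (Nat.modEq_iff_dvd' hl).1 (Eq.symm h), fun h => ((Nat.modEq_iff_dvd' hl).2 h).symm⟩

lemma omegaQ_prime_pow {l n q : ℕ} (hl : l.Prime) (hn : 0 < n) :
    omegaQ (l ^ n) q = if q ∣ l - 1 then 1 else 0 := by
  rw [omegaQ, Nat.primeFactors_prime_pow hn.ne' hl, Finset.filter_singleton]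
  simp only [mod_eq_one_mod_iff hl.pos]
  split_ifs <;> rfl

lemma omegaQ_mul {m n : ℕ} (q : ℕ) (h : m.Coprime n) :
    omegaQ (m * n) q = omegaQ m q + omegaQ n q := by
  rw [omegaQ, h.primeFactors_mul, Finset.filter_union, Finset.card_union_of_disjoint
    (Finset.disjoint_filter_filter h.disjoint_primeFactors)]
  rfl

lemma hasRank_units_prime_pow_bounds {p : ℕ} (hp : p.Prime) (a : ℕ) {l n : ℕ} (hl : l.Prime)
    (hn : 0 < n) :
    ∃ r, HasRank (ZMod (l ^ n))ˣ p a r ∧ omegaQ (l ^ n) (p ^ (a + 1)) ≤ r ∧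
      r ≤ omegaQ (l ^ n) (p ^ (a + 1)) + if p ∣ l ^ n then 2 else 0 := by
  have : NeZero (l ^ n) := ⟨(pow_pos hl.pos n).ne'⟩
  have hcard : Nat.card (ZMod (l ^ n))ˣ = l ^ (n - 1) * (l - 1) := by
    rw [Nat.card_eq_fintype_card, ZMod.card_units_eq_totient, Nat.totient_prime_pow hl hn]
  have hpl : p ∣ l ^ n ↔ p = l :=
    ⟨fun h => (Nat.prime_dvd_prime_iff_eq hp hl).1 (hp.dvd_of_dvd_pow h),
      fun h => h ▸ dvd_pow_self _ hn.ne'⟩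
  simp only [omegaQ_prime_pow hl hn, hpl]
  rcases eq_or_ne l 2 with rfl | hl2
  · have hnd : ¬ p ^ (a + 1) ∣ 2 - 1 := fun h =>
      (Nat.one_lt_pow a.succ_ne_zero hp.one_lt).not_ge (Nat.le_of_dvd one_pos h)
    rw [if_neg hnd]
    rcases eq_or_ne p 2 with rfl | hp2
    · obtain ⟨r, s, hr, hrs, hs⟩ := exists_hasRank (ZMod (2 ^ n))ˣ hp a
      refine ⟨r, hr, Nat.zero_le _, hrs.trans ?_⟩
      have h4 := torsCard_units_two_pow_le n
      have h1 : torsCard (ZMod (2 ^ n))ˣ 1 = 1 := torsCard_eq_one (Nat.coprime_one_right _)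
      rw [HasRank, zero_add, pow_one, pow_zero, h1, mul_one] at hs
      rw [hs, show 4 = 2 ^ 2 by rfl] at h4
      simpa using (Nat.pow_le_pow_iff_right (by norm_num)).1 h4
    · refine ⟨0, ?_, le_rfl, Nat.zero_le _⟩
      have hc (b : ℕ) : (Nat.card (ZMod (2 ^ n))ˣ).Coprime (p ^ b) := by
        rw [hcard, show 2 - 1 = 1 by rfl, mul_one]
        exact Nat.Coprime.pow _ _ ((Nat.coprime_primes Nat.prime_two hp).2 hp2.symm)
      rw [HasRank, torsCard_eq_one (hc _), torsCard_eq_one (hc _)]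
      rfl
  · have := ZMod.isCyclic_units_of_prime_pow l hl hl2 n
    refine ⟨_, hasRank_of_isCyclic _ hp a, ?_, ?_⟩
    · rw [hcard]
      split_ifs with h1 h2
      · exact le_rfl
      · exact absurd (h1.mul_left _) h2
      · exact Nat.zero_le _
      · exact le_rfl
    · rw [hcard]
      rcases eq_or_ne p l with rfl | hne
      · rw [if_pos rfl]
        split_ifs <;> omega
      · have hc : (p ^ (a + 1)).Coprime (l ^ (n - 1)) :=
          Nat.Coprime.pow _ _ ((Nat.coprime_primes hp hl).2 hne)
        simp only [hc.dvd_mul_left]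
        exact Nat.le_add_right _ _

/-- The number of invariant factors of `(ℤ/m)ˣ` divisible by a prime power `q` differs from the
number of primes `l ∣ m`, `l ≡ 1 (mod q)`, by at most two. -/
lemma hasRank_units_bounds {p : ℕ} (hp : p.Prime) (a m : ℕ) (hm : 0 < m) :
    ∃ r, HasRank (ZMod m)ˣ p a r ∧ omegaQ m (p ^ (a + 1)) ≤ r ∧
      r ≤ omegaQ m (p ^ (a + 1)) + if p ∣ m then 2 else 0 := by
  induction m using Nat.recOnPosPrimePosCoprime with
  | zero => exact absurd hm (lt_irrefl 0)
  | one =>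
    refine ⟨0, ?_, by simp [omegaQ], Nat.zero_le _⟩
    rw [HasRank, torsCard_eq_one, torsCard_eq_one]
    · rfl
    all_goals simp
  | prime_pow l n hl hn => exact hasRank_units_prime_pow_bounds hp a hl hn
  | coprime x y hx hy hxy ihx ihy =>
    obtain ⟨r, hr, hr1, hr2⟩ := ihx (by omega)
    obtain ⟨s, hs, hs1, hs2⟩ := ihy (by omega)
    have e := (Units.mapEquiv (ZMod.chineseRemainder hxy).toMulEquiv).trans MulEquiv.prodUnits
    refine ⟨r + s, (hr.prod hs).congr e.symm, ?_, ?_⟩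
    · rw [omegaQ_mul _ hxy]
      omega
    · rw [omegaQ_mul _ hxy]
      have hd : p ∣ x * y ↔ p ∣ x ∨ p ∣ y := hp.dvd_mul
      have hnot : ¬ (p ∣ x ∧ p ∣ y) := fun h => hp.not_dvd_one (hxy ▸ Nat.dvd_gcd h.1 h.2)
      rw [if_congr hd rfl rfl]
      split_ifs at hr2 hs2 ⊢ <;> omega

section chain

variable {K : ℕ} {lam : Fin K → ℕ}

/-- The number of terms of `lam` divisible by `q`. -/
def dvdCount (lam : Fin K → ℕ) (q : ℕ) : ℕ := (Finset.univ.filter fun j => q ∣ lam j).card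

/-- The number of terms of `lam` equal to `d`. -/
def eqCount (lam : Fin K → ℕ) (d : ℕ) : ℕ := (Finset.univ.filter fun j => lam j = d).card

lemma eqCount_add_dvdCount_le (hdvd : ∀ j k : Fin K, j ≤ k → lam j ∣ lam k) {d q q' : ℕ}
    (hq : q ∣ d) (hq' : ¬ q' ∣ d) :
    eqCount lam d = 0 ∨ eqCount lam d + dvdCount lam q' ≤ dvdCount lam q := by
  rcases (Finset.univ.filter fun j => lam j = d).eq_empty_or_nonempty with h | ⟨j₀, hj₀⟩
  · exact .inl (Finset.card_eq_zero.2 h)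
  right
  replace hj₀ : lam j₀ = d := (Finset.mem_filter.1 hj₀).2
  rw [eqCount, dvdCount, ← Finset.card_union_of_disjoint]
  · refine Finset.card_le_card fun j hj => ?_
    simp only [Finset.mem_union, Finset.mem_filter, Finset.mem_univ, true_and] at hj ⊢
    rcases hj with rfl | hj
    · exact hq
    · rcases le_total j j₀ with h | h
      · exact absurd (hj.trans ((hdvd _ _ h).trans hj₀.dvd)) hq'
      · exact hq.trans (hj₀ ▸ hdvd _ _ h)
  · refine Finset.disjoint_filter.2 fun j _ hj h => hq' (hj ▸ h)

lemma exists_dvdCount_le (hdvd : ∀ j k : Fin K, j ≤ k → lam j ∣ lam k) {d : ℕ} (hd : 1 < d) :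
    ∃ q, IsPrimePow q ∧ q ∣ d ∧ (dvdCount lam q ≤ eqCount lam d ∨
      ∃ q', IsPrimePow q' ∧ ¬ q' ∣ d ∧ dvdCount lam q ≤ eqCount lam d + dvdCount lam q') := by
  have hd0 : d ≠ 0 := by omega
  obtain ⟨q, hq, hmin⟩ := (d.divisors.filter IsPrimePow).exists_min_image (dvdCount lam)
    ⟨d.minFac, by simp [hd0, d.minFac_dvd, (Nat.minFac_prime hd.ne').isPrimePow]⟩
  simp only [Finset.mem_filter, Nat.mem_divisors] at hq hmin
  have hall (j : Fin K) (hj : q ∣ lam j) : d ∣ lam j := by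
    rw [Nat.dvd_iff_prime_pow_dvd_dvd]
    intro p k hp hpk
    rcases Nat.eq_zero_or_pos k with rfl | hk
    · simp
    by_contra hnot
    have hsub : (Finset.univ.filter fun i => p ^ k ∣ lam i) ⊂
        Finset.univ.filter fun i => q ∣ lam i := by
      refine Finset.ssubset_iff_of_subset (fun i hi => ?_) |>.2 ⟨j, by simpa, by simpa⟩
      simp only [Finset.mem_filter, Finset.mem_univ, true_and] at hi ⊢
      rcases le_total i j with h | h
      · exact absurd (hi.trans (hdvd _ _ h)) hnot
      · exact hj.trans (hdvd _ _ h)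
    exact (Finset.card_lt_card hsub).not_ge (hmin _ ⟨⟨hpk, hd0⟩, hp.isPrimePow.pow hk.ne'⟩)
  refine ⟨q, hq.2, hq.1.1, ?_⟩
  rcases (Finset.univ.filter fun j => q ∣ lam j ∧ lam j ≠ d).eq_empty_or_nonempty with h | h
  · left
    refine Finset.card_le_card (Finset.monotone_filter_right _ fun j _ hj => ?_)
    by_contra hne
    exact (Finset.eq_empty_iff_forall_notMem.1 h j) (by simp [hj, hne])
  right
  obtain ⟨j₁, hj₁, hj₁min⟩ := Finset.exists_min_image _ id h
  simp only [Finset.mem_filter, Finset.mem_univ, true_and, id] at hj₁ hj₁min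
  have hndvd : ¬ lam j₁ ∣ d := fun h => hj₁.2 (Nat.dvd_antisymm h (hall _ hj₁.1))
  rw [Nat.dvd_iff_prime_pow_dvd_dvd] at hndvd
  push Not at hndvd
  obtain ⟨p, k, hp, hpk, hpk'⟩ := hndvd
  have hk : k ≠ 0 := by
    rintro rfl
    simp at hpk'
  refine ⟨p ^ k, hp.isPrimePow.pow hk, hpk', ?_⟩
  rw [dvdCount, eqCount, dvdCount]
  refine le_trans (Finset.card_le_card fun j hj => ?_) (Finset.card_union_le _ _)
  simp only [Finset.mem_union, Finset.mem_filter, Finset.mem_univ, true_and] at hj ⊢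
  by_cases he : lam j = d
  · exact .inl he
  · exact .inr (hpk.trans (hdvd _ _ (hj₁min j ⟨hj, he⟩)))

end chain

lemma omegaQ_le_dvdCount {m : ℕ} (hm : 0 < m) {K : ℕ} {lam : Fin K → ℕ} (hlam : ∀ j, 1 < lam j)
    (e : (ZMod m)ˣ ≃* Multiplicative (∀ j : Fin K, ZMod (lam j))) {q : ℕ} (hq : IsPrimePow q) :
    omegaQ m q ≤ dvdCount lam q ∧ dvdCount lam q ≤ omegaQ m q + 2 := by
  obtain ⟨p, k, hp, hk, rfl⟩ := (isPrimePow_nat_iff _).1 hq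
  obtain ⟨a, rfl⟩ := Nat.exists_eq_add_of_le' hk
  have : NeZero m := ⟨hm.ne'⟩
  obtain ⟨r, hr, hr1, hr2⟩ := hasRank_units_bounds hp a m hm
  have hr' : r = dvdCount lam (p ^ (a + 1)) :=
    hr.unique hp.one_lt ((hasRank_multiplicative_pi lam hlam hp a).congr e.symm)
  subst hr'
  exact ⟨hr1, hr2.trans (Nat.add_le_add_left (by split_ifs <;> omega) _)⟩

/-- Upper bound for an invariant-factor count. -/
lemma IsInvCount.le {d : ℕ} {J : ℕ → ℕ} (hJ : IsInvCount d J) {m : ℕ} (hm : 0 < m) {q q' : ℕ}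
    (hq : IsPrimePow q) (hqd : q ∣ d) (hq' : IsPrimePow q') (hqd' : ¬ q' ∣ d) :
    J m = 0 ∨ J m + omegaQ m q' ≤ omegaQ m q + 2 := by
  have : NeZero m := ⟨hm.ne'⟩
  obtain ⟨K, lam, h1, h2, ⟨e⟩⟩ := exists_invariant_factors (ZMod m)ˣ
  rw [hJ m hm K lam h1 h2 ⟨e⟩]
  have := omegaQ_le_dvdCount hm h1 e hq
  have := omegaQ_le_dvdCount hm h1 e hq'
  rcases eqCount_add_dvdCount_le h2 hqd hqd' with h | h
  · exact .inl h
  · right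
    rw [eqCount] at h
    omega

/-- Lower bound for an invariant-factor count. -/
lemma IsInvCount.ge {d : ℕ} (hd : 1 < d) {J : ℕ → ℕ} (hJ : IsInvCount d J) {m : ℕ} (hm : 0 < m) :
    ∃ q, IsPrimePow q ∧ q ∣ d ∧ (omegaQ m q ≤ J m ∨
      ∃ q', IsPrimePow q' ∧ ¬ q' ∣ d ∧ omegaQ m q ≤ J m + (omegaQ m q' + 2)) := by
  have : NeZero m := ⟨hm.ne'⟩
  obtain ⟨K, lam, h1, h2, ⟨e⟩⟩ := exists_invariant_factors (ZMod m)ˣ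
  rw [hJ m hm K lam h1 h2 ⟨e⟩]
  obtain ⟨q, hq, hqd, h⟩ := exists_dvdCount_le h2 hd
  have hω := omegaQ_le_dvdCount hm h1 e hq
  refine ⟨q, hq, hqd, ?_⟩
  rcases h with h | ⟨q', hq', hqd', h⟩
  · exact .inl (hω.1.trans h)
  · have := omegaQ_le_dvdCount hm h1 e hq'
    rw [eqCount] at h
    exact .inr ⟨q', hq', hqd', by omega⟩

lemma divCount_primesAP {m n : ℕ} (hm : m ∈ Finset.Icc 1 n) (q : ℕ) :
    divCount (primesAP q n) m = omegaQ m q := by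
  rw [Finset.mem_Icc] at hm
  rw [divCount, omegaQ]
  congr 1
  ext p
  simp only [primesAP, Finset.mem_filter, Finset.mem_Icc, Nat.mem_primeFactors]
  constructor
  · rintro ⟨⟨-, hp, h⟩, hd⟩
    exact ⟨⟨hp, hd, by omega⟩, h⟩
  · rintro ⟨⟨hp, hd, -⟩, h⟩
    exact ⟨⟨⟨hp.pos, (Nat.le_of_dvd hm.1 hd).trans hm.2⟩, hp, h⟩, hd⟩

lemma IsPrimePow.le_two_mul_totient {q : ℕ} (hq : IsPrimePow q) : q ≤ 2 * q.totient := by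
  obtain ⟨p, k, hp, hk, rfl⟩ := (isPrimePow_nat_iff _).1 hq
  obtain ⟨a, rfl⟩ := Nat.exists_eq_add_of_le' hk
  rw [Nat.totient_prime_pow hp hk, pow_succ, mul_left_comm]
  exact Nat.mul_le_mul_left _ (by have := hp.two_le; omega)

lemma ppKey_lt_of_totient_lt {q r : ℕ} (hq : IsPrimePow q) (h : q.totient < r.totient) :
    ppKey q < ppKey r := by
  have := hq.le_two_mul_totient
  have : (q.totient + 1) ^ 2 ≤ r.totient ^ 2 := Nat.pow_le_pow_left h 2
  rw [ppKey, ppKey]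
  nlinarith

lemma totient_le_of_ppKey_le {q r : ℕ} (hr : IsPrimePow r) (h : ppKey q ≤ ppKey r) :
    q.totient ≤ r.totient := by
  by_contra! hlt
  exact h.not_gt (ppKey_lt_of_totient_lt hr hlt)

lemma ppKey_injOn {q r : ℕ} (hq : IsPrimePow q) (hr : IsPrimePow r) (h : ppKey q = ppKey r) :
    q = r := by
  have := (totient_le_of_ppKey_le hr h.le).antisymm (totient_le_of_ppKey_le hq h.ge)
  rw [ppKey, ppKey, this] at h
  omega

lemma infinite_setOf_ppKey : {k | ∃ q : ℕ, IsPrimePow q ∧ ppKey q = k}.Infinite := by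
  refine Set.infinite_of_forall_exists_gt fun n => ?_
  obtain ⟨p, hp, hprime⟩ := Nat.exists_infinite_primes (n + 1)
  exact ⟨_, ⟨p, hprime.isPrimePow, rfl⟩, by rw [ppKey]; omega⟩

lemma qt_spec (i : ℕ) : IsPrimePow (qt i) ∧ ppKey (qt i) = ppNthKey (i - 1) :=
  Nat.sInf_mem (s := {q : ℕ | IsPrimePow q ∧ ppKey q = ppNthKey (i - 1)})
    (Nat.nth_mem_of_infinite infinite_setOf_ppKey (i - 1))

lemma ppKey_qt_lt {i j : ℕ} (hi : 1 ≤ i) (hij : i < j) : ppKey (qt i) < ppKey (qt j) := by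
  rw [(qt_spec i).2, (qt_spec j).2]
  exact Nat.nth_strictMono infinite_setOf_ppKey (by omega)

lemma ppKey_qt_le {i j : ℕ} (hi : 1 ≤ i) (hij : i ≤ j) : ppKey (qt i) ≤ ppKey (qt j) := by
  rcases hij.eq_or_lt with rfl | h
  · exact le_rfl
  · exact (ppKey_qt_lt hi h).le

lemma totient_qt_le {i j : ℕ} (hi : 1 ≤ i) (hij : i ≤ j) :
    (qt i).totient ≤ (qt j).totient :=
  totient_le_of_ppKey_le (qt_spec j).1 (ppKey_qt_le hi hij)

lemma exists_qt_eq {q : ℕ} (hq : IsPrimePow q) : ∃ j, 1 ≤ j ∧ qt j = q := by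
  have h : ppKey q ∈ Set.range (Nat.nth fun k => ∃ q : ℕ, IsPrimePow q ∧ ppKey q = k) := by
    rw [Nat.range_nth_of_infinite infinite_setOf_ppKey]
    exact ⟨q, hq, rfl⟩
  obtain ⟨n, hn⟩ := h
  exact ⟨n + 1, by omega, ppKey_injOn (qt_spec _).1 hq ((qt_spec _).2.trans hn)⟩

lemma IsPrimePow.exists_dvd_of_dvd_lcm {q : ℕ} (hq : IsPrimePow q) (s : Finset ℕ) (f : ℕ → ℕ)
    (hf : ∀ j ∈ s, f j ≠ 0) (h : q ∣ s.lcm f) : ∃ j ∈ s, q ∣ f j := by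
  classical
  induction s using Finset.induction_on with
  | empty =>
    rw [Finset.lcm_empty] at h
    exact absurd (Nat.dvd_one.1 h) hq.ne_one
  | insert a s _ ih =>
    have hs0 : s.lcm f ≠ 0 := by
      rw [Ne, Finset.lcm_eq_zero_iff]
      rintro ⟨j, hj, h0⟩
      exact hf j (Finset.mem_insert_of_mem hj) h0
    rw [Finset.lcm_insert] at h
    have h' : q ∣ f a ∨ q ∣ s.lcm f := by
      obtain ⟨p, k, hp, -, rfl⟩ := (isPrimePow_nat_iff _).1 hq
      have ha0 := hf a (Finset.mem_insert_self _ _)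
      change p ^ k ∣ (f a).lcm (s.lcm f) at h
      rw [hp.pow_dvd_iff_le_factorization (Nat.lcm_ne_zero ha0 hs0),
        Nat.factorization_lcm ha0 hs0, Finsupp.sup_apply, le_sup_iff] at h
      rwa [hp.pow_dvd_iff_le_factorization ha0, hp.pow_dvd_iff_le_factorization hs0]
    rcases h' with h' | h'
    · exact ⟨a, Finset.mem_insert_self _ _, h'⟩
    · obtain ⟨j, hj, hd⟩ := ih (fun j hj => hf j (Finset.mem_insert_of_mem hj)) h'
      exact ⟨j, Finset.mem_insert_of_mem hj, hd⟩

lemma qt_dvd_Lseq {i j : ℕ} (hj : 1 ≤ j) (hji : j ≤ i) : qt j ∣ Lseq i :=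
  Finset.dvd_lcm (Finset.mem_Icc.2 ⟨hj, hji⟩)

lemma not_qt_dvd_Lseq {i j : ℕ} (hij : i < j) : ¬ qt j ∣ Lseq i := fun h => by
  obtain ⟨l, hl, hd⟩ := (qt_spec j).1.exists_dvd_of_dvd_lcm _ _
    (fun l _ => (qt_spec l).1.ne_zero) h
  rw [Finset.mem_Icc] at hl
  refine (ppKey_qt_lt hl.1 (hl.2.trans_lt hij)).not_ge ?_
  have h1 := Nat.le_of_dvd (qt_spec l).1.pos hd
  have h2 := Nat.le_of_dvd (Nat.totient_pos.2 (qt_spec l).1.pos) (Nat.totient_dvd_of_dvd hd)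
  rw [ppKey, ppKey]
  gcongr

lemma coprime_and_eq_of_totient_eq {q r : ℕ} (hq : IsPrimePow q) (hr : IsPrimePow r)
    (hne : q ≠ r) (h : q.totient = r.totient) :
    q.Coprime r ∧ (q = q.totient + 1 ∨ r = q.totient + 1) := by
  have key {p l a b : ℕ} (hp : p.Prime) (hl : l.Prime) (hpl : p < l)
      (h : (p ^ (a + 1)).totient = (l ^ (b + 1)).totient) : b = 0 := by
    rw [Nat.totient_prime_pow_succ hp, Nat.totient_prime_pow_succ hl] at h
    by_contra hb
    have hd : l ∣ p ^ a * (p - 1) := h ▸ (dvd_pow_self l hb).mul_right _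
    rcases hl.dvd_mul.1 hd with h' | h'
    · exact hpl.ne' ((Nat.prime_dvd_prime_iff_eq hl hp).1 (hl.dvd_of_dvd_pow h'))
    · have := Nat.le_of_dvd (by have := hp.two_le; omega) h'
      omega
  obtain ⟨p, k, hp, hk, rfl⟩ := (isPrimePow_nat_iff _).1 hq
  obtain ⟨l, j, hl, hj, rfl⟩ := (isPrimePow_nat_iff _).1 hr
  obtain ⟨a, rfl⟩ := Nat.exists_eq_add_of_le' hk
  obtain ⟨b, rfl⟩ := Nat.exists_eq_add_of_le' hj
  have hpl : p ≠ l := by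
    rintro rfl
    rw [Nat.totient_prime_pow_succ hp, Nat.totient_prime_pow_succ hp] at h
    have := Nat.pow_right_injective hp.two_le
      (Nat.eq_of_mul_eq_mul_right (by have := hp.two_le; omega) h)
    exact hne (by rw [this])
  refine ⟨Nat.Coprime.pow _ _ ((Nat.coprime_primes hp hl).2 hpl), ?_⟩
  have h1 := hp.pos
  have h2 := hl.pos
  rcases hpl.lt_or_gt with hlt | hlt
  · obtain rfl := key hp hl hlt h
    right
    rw [h, zero_add, pow_one, Nat.totient_prime hl]
    omega
  · obtain rfl := key hl hp hlt h.symm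
    left
    rw [zero_add, pow_one, Nat.totient_prime hp]
    omega

lemma totient_qt_lt_of_ncard_UFO {i : ℕ} (h : (UFO i).ncard = 1) :
    (qt i).totient < (qt (i + 1)).totient := by
  by_contra hlt
  rw [UFO, if_neg hlt, Set.ncard_eq_one] at h
  obtain ⟨a, ha⟩ := h
  have h1 : Lseq i = a := by
    rw [← Set.mem_singleton_iff, ← ha]
    exact Set.mem_insert _ _
  have h2 : Nat.lcm (Lseq (i - 1)) (qt (i + 1)) = a := by
    rw [← Set.mem_singleton_iff, ← ha]
    exact Set.mem_insert_of_mem _ rfl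
  exact not_qt_dvd_Lseq i.lt_succ_self (h1.trans h2.symm ▸ Nat.dvd_lcm_right _ _)

lemma totient_qt_eq_of_ncard_UFO {i : ℕ} (hi : 1 ≤ i) (h : (UFO i).ncard = 2) :
    (qt i).totient = (qt (i + 1)).totient := by
  by_contra hne
  rw [UFO, if_pos (lt_of_le_of_ne (totient_qt_le hi i.le_succ) hne), Set.ncard_singleton] at h
  omega

lemma eq_or_totient_lt_of_dvd_Lseq {i : ℕ} (hi : 1 ≤ i)
    (h : (qt i).totient = (qt (i + 1)).totient) {q : ℕ} (hq : IsPrimePow q)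
    (hd : q ∣ Lseq (i + 1)) :
    q = qt i ∨ q = qt (i + 1) ∨ q.totient < (qt (i + 1)).totient := by
  obtain ⟨j, hj, rfl⟩ := exists_qt_eq hq
  have hji : j ≤ i + 1 := by
    by_contra! hlt
    exact not_qt_dvd_Lseq hlt hd
  rcases hji.eq_or_lt with rfl | hji
  · exact .inr (.inl rfl)
  rcases (Nat.lt_succ_iff.1 hji).eq_or_lt with rfl | hji
  · exact .inl rfl
  refine .inr (.inr (lt_of_le_of_ne (totient_qt_le hj (by omega)) fun heq => ?_))
  have hne {a b : ℕ} (ha : 1 ≤ a) (hab : a < b) : qt a ≠ qt b := fun h =>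
    (ppKey_qt_lt ha hab).ne (congrArg ppKey h)
  have n1 := hne hj hji
  have n2 := hne hj (hji.trans i.lt_succ_self)
  have n3 := hne hi i.lt_succ_self
  have c1 := (coprime_and_eq_of_totient_eq hq (qt_spec i).1 n1 (heq.trans h.symm)).2
  have c2 := (coprime_and_eq_of_totient_eq hq (qt_spec _).1 n2 heq).2
  have c3 := (coprime_and_eq_of_totient_eq (qt_spec _).1 (qt_spec _).1 n3 h).2
  rw [Nat.succ_eq_add_one] at *
  omega

lemma eq_or_totient_lt_of_not_dvd_Lseq {i : ℕ}
    (h : (qt (i + 1)).totient < (qt (i + 2)).totient) {q : ℕ} (hq : IsPrimePow q)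
    (hd : ¬ q ∣ Lseq i) : q = qt (i + 1) ∨ (qt (i + 1)).totient < q.totient := by
  obtain ⟨j, hj, rfl⟩ := exists_qt_eq hq
  have hij : i + 1 ≤ j := by
    by_contra! hlt
    exact hd (qt_dvd_Lseq hj (by omega))
  rcases hij.eq_or_lt with rfl | hij
  · exact .inl rfl
  · exact .inr (h.trans_le (totient_qt_le (by omega) hij))

/-- The averages of `f n` over `{1, …, n}` are eventually bounded above. -/
def BddMean (f : ℕ → ℕ → ℝ) : Prop := ∃ C, ∀ᶠ n in atTop, mean n (f n) ≤ C

lemma BddMean.add {f g : ℕ → ℕ → ℝ} (hf : BddMean f) (hg : BddMean g) :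
    BddMean fun n m => f n m + g n m := by
  obtain ⟨C, hC⟩ := hf
  obtain ⟨D, hD⟩ := hg
  refine ⟨C + D, ?_⟩
  filter_upwards [hC, hD] with n h1 h2
  rw [mean_add]
  exact add_le_add h1 h2

lemma bddMean_const (c : ℝ) : BddMean fun _ _ => c :=
  ⟨c, (eventually_gt_atTop 0).mono fun _ hn => (mean_const hn c).le⟩

lemma BddMean.sum {ι : Type*} (s : Finset ι) {f : ι → ℕ → ℕ → ℝ} (h : ∀ r ∈ s, BddMean (f r)) :
    BddMean fun n m => ∑ r ∈ s, f r n m := by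
  classical
  induction s using Finset.induction_on with
  | empty => simpa using bddMean_const 0
  | insert a s ha ih =>
    simp only [Finset.sum_insert ha]
    exact (h a (Finset.mem_insert_self _ _)).add
      (ih fun r hr => h r (Finset.mem_insert_of_mem hr))

/-- The excess of the number of primes `p ≡ 1 (mod q)` dividing `m` over `c * log log n`. -/
def excess (q : ℕ) (c : ℝ) (n m : ℕ) : ℝ := max ((divCount (primesAP q n) m : ℝ) - c * LL n) 0

/-- The deficit of the number of primes `p ≡ 1 (mod q)` dividing `m` from `c * log log n`. -/
def deficit (q : ℕ) (c : ℝ) (n m : ℕ) : ℝ := max (c * LL n - (divCount (primesAP q n) m : ℝ)) 0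

lemma excess_nonneg (q : ℕ) (c : ℝ) (n m : ℕ) : 0 ≤ excess q c n m := le_max_right _ _

lemma deficit_nonneg (q : ℕ) (c : ℝ) (n m : ℕ) : 0 ≤ deficit q c n m := le_max_right _ _

lemma le_add_excess (q : ℕ) (c : ℝ) (n m : ℕ) :
    (divCount (primesAP q n) m : ℝ) ≤ c * LL n + excess q c n m :=
  sub_le_iff_le_add'.1 (le_max_left _ _)

lemma sub_deficit_le (q : ℕ) (c : ℝ) (n m : ℕ) :
    c * LL n - deficit q c n m ≤ (divCount (primesAP q n) m : ℝ) :=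
  sub_le_comm.1 (le_max_left _ _)

lemma bddMean_excess {q : ℕ} (hq : 0 < q) {c : ℝ} (hc : (q.totient : ℝ)⁻¹ < c) :
    BddMean (excess q c) := by
  obtain ⟨C, hC⟩ := exists_mean_max_divCount_sub_le q hq (c := c) (s := 1) (by norm_num)
    (by linarith)
  simp only [one_mul] at hC
  exact ⟨C, hC⟩

lemma bddMean_deficit {q : ℕ} (hq : 0 < q) {c : ℝ} (hc : c < (q.totient : ℝ)⁻¹) :
    BddMean (deficit q c) := by
  obtain ⟨C, hC⟩ := exists_mean_max_divCount_sub_le q hq (c := c) (s := -1) (by norm_num)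
    (by linarith)
  simp only [neg_one_mul, neg_sub] at hC
  exact ⟨C, hC⟩

lemma inv_totient_lt {q r : ℕ} (hq : 0 < q) (h : q.totient < r.totient) :
    (r.totient : ℝ)⁻¹ < (q.totient : ℝ)⁻¹ :=
  inv_strictAnti₀ (by exact_mod_cast Nat.totient_pos.2 hq) (by exact_mod_cast h)

/-- The main term approximating an invariant-factor count. -/
def mainTerm (q₁ q₂ q₃ n m : ℕ) : ℝ :=
  min (divCount (primesAP q₁ n) m : ℝ) (divCount (primesAP q₂ n) m) - divCount (primesAP q₃ n) m

section comparison

variable {q₁ q₂ q₃ d : ℕ} {J : ℕ → ℕ}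

lemma IsInvCount.exists_le_mainTerm_add (hJ : IsInvCount d J) (h₁ : IsPrimePow q₁)
    (h₂ : IsPrimePow q₂) (h₃ : IsPrimePow q₃) (hd₁ : q₁ ∣ d) (hd₂ : q₂ ∣ d) (hd₃ : ¬ q₃ ∣ d)
    (h₁₂ : q₁.totient = q₂.totient) (h₂₃ : q₂.totient < q₃.totient) :
    ∃ E, BddMean E ∧ ∀ n, ∀ m ∈ Finset.Icc 1 n, (J m : ℝ) ≤ mainTerm q₁ q₂ q₃ n m + E n m := by
  obtain ⟨a, ha₃, ha₂⟩ := exists_between (inv_totient_lt h₂.pos h₂₃)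
  refine ⟨fun n m => 2 + excess q₃ a n m + deficit q₁ a n m + deficit q₂ a n m,
    (((bddMean_const 2).add (bddMean_excess h₃.pos ha₃)).add
      (bddMean_deficit h₁.pos (h₁₂ ▸ ha₂))).add (bddMean_deficit h₂.pos ha₂), fun n m hm => ?_⟩
  have hm0 : 0 < m := (Finset.mem_Icc.1 hm).1
  have e₃ := le_add_excess q₃ a n m
  have p₃ := excess_nonneg q₃ a n m
  have e₁ := sub_deficit_le q₁ a n m
  have p₁ := deficit_nonneg q₁ a n m
  have e₂ := sub_deficit_le q₂ a n m
  have p₂ := deficit_nonneg q₂ a n m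
  rw [mainTerm, sub_add_eq_add_sub, le_sub_iff_add_le, ← sub_le_iff_le_add, le_min_iff]
  have key {q : ℕ} (hq : IsPrimePow q) (hqd : q ∣ d)
      (e : a * LL n - deficit q a n m ≤ (divCount (primesAP q n) m : ℝ))
      (p : deficit q a n m ≤ deficit q₁ a n m + deficit q₂ a n m) :
      (J m : ℝ) + divCount (primesAP q₃ n) m - (2 + excess q₃ a n m + deficit q₁ a n m +
        deficit q₂ a n m) ≤ divCount (primesAP q n) m := by
    rcases hJ.le hm0 hq hqd h₃ hd₃ with h | h
    · rw [h, Nat.cast_zero]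
      linarith
    · rw [← divCount_primesAP hm, ← divCount_primesAP hm] at h
      have h' : (J m : ℝ) + divCount (primesAP q₃ n) m ≤ divCount (primesAP q n) m + 2 := by
        exact_mod_cast h
      linarith
  exact ⟨key h₁ hd₁ e₁ (by linarith), key h₂ hd₂ e₂ (by linarith)⟩

lemma omegaQ_eq_zero_of_lt {m q : ℕ} (hm : 0 < m) (h : m < q) : omegaQ m q = 0 := by
  rw [omegaQ, Finset.card_eq_zero, Finset.filter_eq_empty_iff]
  intro p hp
  have hle := Nat.le_of_dvd hm (Nat.dvd_of_mem_primeFactors hp)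
  have h2 := (Nat.prime_of_mem_primeFactors hp).two_le
  rw [Nat.mod_eq_of_lt (by omega), Nat.mod_eq_of_lt (by omega)]
  omega

lemma exists_min_le_divCount_add (hd0 : d ≠ 0) (h₁ : 0 < q₁)
    (hd : ∀ q, IsPrimePow q → q ∣ d → q = q₁ ∨ q = q₂ ∨ q.totient < q₁.totient) :
    ∃ E, BddMean E ∧ ∀ q, IsPrimePow q → q ∣ d → ∀ n m,
      min (divCount (primesAP q₁ n) m : ℝ) (divCount (primesAP q₂ n) m) ≤
        divCount (primesAP q n) m + E n m := by
  let D := d.divisors.filter fun q => q.totient < q₁.totient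
  have ha (q : ℕ) : ∃ a : ℝ, q ∈ D → (q₁.totient : ℝ)⁻¹ < a ∧ a < (q.totient : ℝ)⁻¹ := by
    by_cases hq : q ∈ D
    · simp only [D, Finset.mem_filter] at hq
      obtain ⟨a, h⟩ := exists_between (inv_totient_lt (Nat.pos_of_mem_divisors hq.1) hq.2)
      exact ⟨a, fun _ => h⟩
    · exact ⟨0, fun h => absurd h hq⟩
  choose a ha using ha
  have hnn (n m q : ℕ) : 0 ≤ excess q₁ (a q) n m + deficit q (a q) n m :=
    add_nonneg (excess_nonneg _ _ _ _) (deficit_nonneg _ _ _ _)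
  refine ⟨fun n m => ∑ q ∈ D, (excess q₁ (a q) n m + deficit q (a q) n m),
    BddMean.sum D fun q hq => (bddMean_excess h₁ (ha q hq).1).add (bddMean_deficit
      (Nat.pos_of_mem_divisors (Finset.mem_filter.1 hq).1) (ha q hq).2), fun q hq hqd n m => ?_⟩
  have hs : 0 ≤ ∑ q ∈ D, (excess q₁ (a q) n m + deficit q (a q) n m) :=
    Finset.sum_nonneg fun q _ => hnn n m q
  rcases hd q hq hqd with rfl | rfl | hlt
  · exact (min_le_left _ _).trans (le_add_of_nonneg_right hs)
  · exact (min_le_right _ _).trans (le_add_of_nonneg_right hs)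
  · have hmem : q ∈ D := Finset.mem_filter.2 ⟨Nat.mem_divisors.2 ⟨hqd, hd0⟩, hlt⟩
    have h := Finset.single_le_sum (fun q _ => hnn n m q) hmem
    have e₁ := le_add_excess q₁ (a q) n m
    have e := sub_deficit_le q (a q) n m
    exact (min_le_left _ _).trans (by linarith)

lemma exists_divCount_le_add (h₃ : 0 < q₃)
    (hd : ∀ q, IsPrimePow q → ¬ q ∣ d → q = q₃ ∨ q₃.totient < q.totient) :
    ∃ E, BddMean E ∧ (∀ n m, 0 ≤ E n m) ∧ ∀ q, IsPrimePow q → ¬ q ∣ d → ∀ n, ∀ m ∈ Finset.Icc 1 n,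
      (divCount (primesAP q n) m : ℝ) ≤ divCount (primesAP q₃ n) m + E n m := by
  have hφ : (0 : ℝ) < q₃.totient := by exact_mod_cast Nat.totient_pos.2 h₃
  obtain ⟨b, hb, hb₃⟩ := exists_between
    (inv_strictAnti₀ hφ (lt_add_one (q₃.totient : ℝ)))
  have hb0 : 0 < b := lt_trans (by positivity) hb
  obtain ⟨Q, C, hC⟩ := exists_mean_sum_max_divCount_sub_le hb0
  let D := (Finset.Icc 1 Q).filter fun q => q₃.totient < q.totient
  refine ⟨fun n m => deficit q₃ b n m + ∑ q ∈ D, excess q b n m +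
    ∑ q ∈ (Finset.Ioc Q n).filter IsPrimePow, excess q b n m,
    ((bddMean_deficit h₃ hb₃).add (BddMean.sum D fun q hq => ?_)).add ⟨C, hC⟩, fun n m => ?_,
    fun q hq hqd n m hm => ?_⟩
  · simp only [D, Finset.mem_filter, Finset.mem_Icc] at hq
    refine bddMean_excess hq.1.1 (lt_of_le_of_lt ?_ hb)
    exact inv_anti₀ (by positivity) (by exact_mod_cast hq.2)
  · have := deficit_nonneg q₃ b n m
    have : 0 ≤ ∑ q ∈ D, excess q b n m := Finset.sum_nonneg fun q _ => excess_nonneg _ _ _ _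
    have : 0 ≤ ∑ q ∈ (Finset.Ioc Q n).filter IsPrimePow, excess q b n m :=
      Finset.sum_nonneg fun q _ => excess_nonneg _ _ _ _
    positivity
  · have n₁ := deficit_nonneg q₃ b n m
    have n₂ : 0 ≤ ∑ q ∈ D, excess q b n m := Finset.sum_nonneg fun q _ => excess_nonneg _ _ _ _
    have n₃ : 0 ≤ ∑ q ∈ (Finset.Ioc Q n).filter IsPrimePow, excess q b n m :=
      Finset.sum_nonneg fun q _ => excess_nonneg _ _ _ _
    have e₃ := sub_deficit_le q₃ b n m
    have e := le_add_excess q b n m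
    rcases hd q hq hqd with rfl | hlt
    · linarith
    rcases le_or_gt q Q with hqQ | hqQ
    · have hmem : q ∈ D :=
        Finset.mem_filter.2 ⟨Finset.mem_Icc.2 ⟨hq.pos, hqQ⟩, hlt⟩
      have := Finset.single_le_sum (fun q _ => excess_nonneg q b n m) hmem
      linarith
    rcases le_or_gt q n with hqn | hqn
    · have hmem : q ∈ (Finset.Ioc Q n).filter IsPrimePow :=
        Finset.mem_filter.2 ⟨Finset.mem_Ioc.2 ⟨hqQ, hqn⟩, hq⟩
      have := Finset.single_le_sum (fun q _ => excess_nonneg q b n m) hmem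
      linarith
    · have hm' := Finset.mem_Icc.1 hm
      rw [divCount_primesAP hm q, omegaQ_eq_zero_of_lt hm'.1 (hm'.2.trans_lt hqn), Nat.cast_zero]
      positivity

lemma IsInvCount.exists_mainTerm_le_add (hd1 : 1 < d) (hJ : IsInvCount d J) (h₁ : 0 < q₁)
    (h₃ : 0 < q₃)
    (hd : ∀ q, IsPrimePow q → q ∣ d → q = q₁ ∨ q = q₂ ∨ q.totient < q₁.totient)
    (hnd : ∀ q, IsPrimePow q → ¬ q ∣ d → q = q₃ ∨ q₃.totient < q.totient) :
    ∃ E, BddMean E ∧ ∀ n, ∀ m ∈ Finset.Icc 1 n, mainTerm q₁ q₂ q₃ n m ≤ (J m : ℝ) + E n m := by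
  obtain ⟨E, hE, hmin⟩ := exists_min_le_divCount_add (by omega) h₁ hd
  obtain ⟨F, hF, hF0, hmax⟩ := exists_divCount_le_add h₃ hnd
  refine ⟨fun n m => 2 + E n m + F n m, ((bddMean_const 2).add hE).add hF, fun n m hm => ?_⟩
  obtain ⟨q, hq, hqd, h⟩ := hJ.ge hd1 (Finset.mem_Icc.1 hm).1
  have h1 := hmin q hq hqd n m
  have h2 := hF0 n m
  have h3 : (0 : ℝ) ≤ divCount (primesAP q₃ n) m := Nat.cast_nonneg _
  rw [mainTerm]
  rcases h with h | ⟨q', hq', hqd', h⟩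
  · rw [← divCount_primesAP hm] at h
    have h' : (divCount (primesAP q n) m : ℝ) ≤ J m := by exact_mod_cast h
    linarith
  · rw [← divCount_primesAP hm, ← divCount_primesAP hm] at h
    have h' : (divCount (primesAP q n) m : ℝ) ≤ J m + (divCount (primesAP q' n) m + 2) := by
      exact_mod_cast h
    have := hmax q' hq' hqd' n m hm
    linarith

end comparison

lemma exists_abs_mean_mainTerm_sub_le {q₁ q₂ q₃ : ℕ} (h₁ : 0 < q₁) (h₂ : 0 < q₂) (h₃ : 0 < q₃)
    (h₁₂ : q₁.totient = q₂.totient) :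
    ∃ C, ∀ᶠ n in atTop, |mean n (mainTerm q₁ q₂ q₃ n) -
      (((q₂.totient : ℝ)⁻¹ - (q₃.totient : ℝ)⁻¹) * LL n - 2⁻¹ * mean n (fun m =>
        |(divCount (primesAP q₁ n) m : ℝ) - divCount (primesAP q₂ n) m|))| ≤ C := by
  obtain ⟨C₁, hC₁⟩ := exists_abs_mean_divCount_sub_le q₁ h₁
  obtain ⟨C₂, hC₂⟩ := exists_abs_mean_divCount_sub_le q₂ h₂
  obtain ⟨C₃, hC₃⟩ := exists_abs_mean_divCount_sub_le q₃ h₃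
  refine ⟨2⁻¹ * (C₁ + C₂) + C₃, ?_⟩
  filter_upwards [hC₁, hC₂, hC₃] with n b₁ b₂ b₃
  have e : mainTerm q₁ q₂ q₃ n = fun m =>
      2⁻¹ * (divCount (primesAP q₁ n) m + divCount (primesAP q₂ n) m -
        |(divCount (primesAP q₁ n) m : ℝ) - divCount (primesAP q₂ n) m|) -
        divCount (primesAP q₃ n) m := by
    funext m
    rw [mainTerm]
    rcases le_total (divCount (primesAP q₁ n) m : ℝ) (divCount (primesAP q₂ n) m) with h | h
    · rw [min_eq_left h, abs_of_nonpos (sub_nonpos.2 h)]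
      ring
    · rw [min_eq_right h, abs_of_nonneg (sub_nonneg.2 h)]
      ring
  rw [e, mean_sub, mean_const_mul, mean_sub, mean_add]
  rw [h₁₂] at b₁
  rw [abs_le, div_eq_mul_inv] at *
  constructor <;> linarith

lemma IsInvCount.exists_abs_avg_sub_le {q₁ q₂ q₃ d : ℕ} {J : ℕ → ℕ} (hd1 : 1 < d)
    (hJ : IsInvCount d J) (h₁ : IsPrimePow q₁) (h₂ : IsPrimePow q₂) (h₃ : IsPrimePow q₃)
    (hd₁ : q₁ ∣ d) (hd₂ : q₂ ∣ d) (hd₃ : ¬ q₃ ∣ d)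
    (h₁₂ : q₁.totient = q₂.totient) (h₂₃ : q₂.totient < q₃.totient)
    (hd : ∀ q, IsPrimePow q → q ∣ d → q = q₁ ∨ q = q₂ ∨ q.totient < q₁.totient)
    (hnd : ∀ q, IsPrimePow q → ¬ q ∣ d → q = q₃ ∨ q₃.totient < q.totient) :
    ∃ C, ∀ᶠ n in atTop, |avg J n - mean n (mainTerm q₁ q₂ q₃ n)| ≤ C := by
  obtain ⟨E, ⟨C, hC⟩, hE⟩ := hJ.exists_le_mainTerm_add h₁ h₂ h₃ hd₁ hd₂ hd₃ h₁₂ h₂₃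
  obtain ⟨F, ⟨D, hD⟩, hF⟩ := hJ.exists_mainTerm_le_add hd1 h₁.pos h₃.pos hd hnd
  refine ⟨max C D, ?_⟩
  filter_upwards [hC, hD] with n hC hD
  have k₁ := mean_mono (hE n)
  have k₂ := mean_mono (hF n)
  rw [mean_add] at k₁ k₂
  change avg J n ≤ _ at k₁
  change _ ≤ avg J n + _ at k₂
  rw [abs_sub_le_iff]
  exact ⟨by linarith [le_max_left C D], by linarith [le_max_right C D]⟩

lemma half_sqrt_pairVar_mul (k : ℕ) :
    2⁻¹ * (√(pairVar k) * √(2 / Real.pi)) =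
      √(1 / (k : ℝ) + 1 / k - 2 / (k * k)) / √(2 * Real.pi) := by
  have hv : (pairVar k : ℝ) = 1 / (k : ℝ) + 1 / k - 2 / (k * k) := by
    rw [pairVar, NNReal.coe_mk, div_eq_mul_inv, div_eq_mul_inv, mul_inv]
    ring
  have hs : √(2 / Real.pi) * √(2 * Real.pi) = 2 := by
    rw [← Real.sqrt_mul (by positivity), show 2 / Real.pi * (2 * Real.pi) = 2 ^ 2 by
      field_simp, Real.sqrt_sq zero_le_two]
  rw [← hv, eq_div_iff (by positivity)]
  linear_combination 2⁻¹ * √(pairVar k) * hs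

theorem statement4 (i : ℕ) (hi : 2 ≤ i)
    (h1 : (UFO (i - 1)).ncard = 2) (h2 : (UFO i).ncard = 1) (h3 : (UFO (i + 1)).ncard = 1)
    (d : ℕ) (hd : UFO i = {d}) (J : ℕ → ℕ) (hJ : IsInvCount d J) :
    Filter.Tendsto (fun n : ℕ => (avg J n - muSeq i * LL n) / Real.sqrt (LL n))
      Filter.atTop (nhds (-(sigSeq (i - 1)) / Real.sqrt (2 * Real.pi))) := by
  obtain ⟨i, rfl⟩ := Nat.exists_eq_add_of_le' hi
  rw [show i + 2 - 1 = i + 1 by omega] at *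
  have h₁₂ : (qt (i + 1)).totient = (qt (i + 2)).totient :=
    totient_qt_eq_of_ncard_UFO (by omega) h1
  have h₂₃ : (qt (i + 2)).totient < (qt (i + 3)).totient := totient_qt_lt_of_ncard_UFO h2
  have h₃₄ : (qt (i + 3)).totient < (qt (i + 4)).totient := totient_qt_lt_of_ncard_UFO h3
  obtain rfl : Lseq (i + 2) = d := by
    rwa [UFO, if_pos h₂₃, Set.singleton_eq_singleton_iff] at hd
  have hne : qt (i + 1) ≠ qt (i + 2) := fun h =>
    (ppKey_qt_lt (by omega) (Nat.lt_succ_self (i + 1))).ne (congrArg ppKey h)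
  have p₁ := (qt_spec (i + 1)).1
  have p₂ := (qt_spec (i + 2)).1
  have p₃ := (qt_spec (i + 3)).1
  have hd₁ : qt (i + 1) ∣ Lseq (i + 2) := qt_dvd_Lseq (by omega) (by omega)
  have hd₂ : qt (i + 2) ∣ Lseq (i + 2) := qt_dvd_Lseq (by omega) le_rfl
  have hL0 : Lseq (i + 2) ≠ 0 := by
    rw [Lseq, Ne, Finset.lcm_eq_zero_iff]
    rintro ⟨j, -, hj⟩
    exact (qt_spec j).1.ne_zero hj
  have hL : 1 < Lseq (i + 2) := p₁.one_lt.trans_le (Nat.le_of_dvd (Nat.pos_of_ne_zero hL0) hd₁)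
  obtain ⟨C, hC⟩ := hJ.exists_abs_avg_sub_le hL p₁ p₂ p₃ hd₁ hd₂
    (not_qt_dvd_Lseq (Nat.lt_succ_self _)) h₁₂ h₂₃
    (fun q hq h => h₁₂ ▸ eq_or_totient_lt_of_dvd_Lseq (by omega) h₁₂ hq h)
    (fun q hq h => eq_or_totient_lt_of_not_dvd_Lseq h₃₄ hq h)
  obtain ⟨D, hD⟩ := exists_abs_mean_mainTerm_sub_le p₁.pos p₂.pos p₃.pos h₁₂
  have hlim := (tendsto_mean_abs_divCount_sub p₁.pos p₂.pos
    (coprime_and_eq_of_totient_eq p₁ p₂ hne h₁₂).1 h₁₂).const_mul (2⁻¹ : ℝ)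
  rw [half_sqrt_pairVar_mul] at hlim
  have herr := squeeze_zero_norm' (f := fun n => (avg J n - muSeq (i + 2) * LL n + 2⁻¹ *
      mean n (fun m => |(divCount (primesAP (qt (i + 1)) n) m : ℝ) -
        divCount (primesAP (qt (i + 2)) n) m|)) / √(LL n)) (by
      filter_upwards [hC, hD] with n hC hD
      rw [Real.norm_eq_abs, abs_div, abs_of_nonneg (Real.sqrt_nonneg _)]
      refine div_le_div_of_nonneg_right ?_ (Real.sqrt_nonneg _)
      refine le_trans (le_of_eq ?_) ((abs_add_le _ _).trans (add_le_add hC hD))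
      congr 1
      simp only [muSeq, phiQ, one_div]
      ring) (tendsto_const_div_sqrt_LL (C + D))
  have hσ : sigSeq (i + 1) = √(1 / ((qt (i + 2)).totient : ℝ) + 1 / (qt (i + 2)).totient -
      2 / ((qt (i + 2)).totient * (qt (i + 2)).totient)) := by
    rw [sigSeq, phiQ, phiQ, h₁₂]
  rw [hσ, neg_div, ← zero_sub]
  refine (herr.sub hlim).congr fun n => ?_
  ring

end
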